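/- Let 0 < ε < 1 and let K be a convex body in ℝⁿ with V(K) = V(B) and 𝓔_{-1}(K)/(n V(B)) ≥ 1 − ε. Let s_{-2}(u) := s_K(u) − e_{-2}(K)·u be the support function of K − e_{-2}(K). Then n V(B)(1 − ε)² ≤ ∫_{S^{n-1}} s_{-2}(u)^{-2} dθ ≤ n V(B); consequently the constant r := (∫_{S^{n-1}} dθ)^{1/2} / (∫_{S^{n-1}} s_{-2}(u)^{-2} dθ)^{1/2} satisfies 1 ≤ r ≤ 1/(1 − ε). -/

import Mathlib

open MeasureTheory Metric Real Set
open scoped Pointwise RealInnerProductSpace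

noncomputable section

/-- The surface measure `dθ` on the unit sphere `S^{n-1}` of `ℝⁿ`
(its total mass is `n·V(B)`). -/
def sphMeasure (n : ℕ) : Measure (Metric.sphere (0 : EuclideanSpace ℝ (Fin n)) 1) :=
  (volume : Measure (EuclideanSpace ℝ (Fin n))).toSphere

/-- `K` is a convex body: compact, convex, with nonempty interior. -/
def IsConvexBody {n : ℕ} (K : Set (EuclideanSpace ℝ (Fin n))) : Prop :=
  IsCompact K ∧ Convex ℝ K ∧ (interior K).Nonempty

/-- The support function of `K`: `s_K(u) = max_{x ∈ K} x·u`. -/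
def supp {n : ℕ} (K : Set (EuclideanSpace ℝ (Fin n))) (u : EuclideanSpace ℝ (Fin n)) : ℝ :=
  sSup ((fun x => ⟪x, u⟫) '' K)

/-- `n`-dimensional Lebesgue measure (volume), as a real number. -/
def vol {n : ℕ} (K : Set (EuclideanSpace ℝ (Fin n))) : ℝ :=
  (volume K).toReal

/-- The closed unit ball `B` of `ℝⁿ`. -/
def unitBall (n : ℕ) : Set (EuclideanSpace ℝ (Fin n)) :=
  Metric.closedBall 0 1

/-- The entropy functional `𝓔(K) = sup_{x ∈ int K} ∫_{S^{n-1}} log (s_K(u) - x·u) dθ`. -/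
def entropy {n : ℕ} (K : Set (EuclideanSpace ℝ (Fin n))) : ℝ :=
  sSup ((fun x => ∫ u, Real.log (supp K u - ⟪x, (u : EuclideanSpace ℝ (Fin n))⟫)
      ∂(sphMeasure n)) '' interior K)

/-- The `p`-entropy functional `𝓔_p(K) = inf_{x ∈ int K} ∫_{S^{n-1}} (s_K(u) - x·u)^p dθ`. -/
def entropyP {n : ℕ} (p : ℝ) (K : Set (EuclideanSpace ℝ (Fin n))) : ℝ :=
  sInf ((fun x => ∫ u, (supp K u - ⟪x, (u : EuclideanSpace ℝ (Fin n))⟫) ^ p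
      ∂(sphMeasure n)) '' interior K)

/-- The Hausdorff distance between convex bodies,
`δ_H(K,L) = sup_{u ∈ S^{n-1}} |s_K(u) - s_L(u)|`. -/
def hdist {n : ℕ} (K L : Set (EuclideanSpace ℝ (Fin n))) : ℝ :=
  ⨆ u : Metric.sphere (0 : EuclideanSpace ℝ (Fin n)) 1, |supp K u - supp L u|

/-- The radius `r = (∫_{S^{n-1}} dθ)^{1/2} / (∫_{S^{n-1}} (s_K(u) - e·u)^{-2} dθ)^{1/2}`. -/
def rConst {n : ℕ} (K : Set (EuclideanSpace ℝ (Fin n))) (e : EuclideanSpace ℝ (Fin n)) : ℝ :=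
  ((sphMeasure n) Set.univ).toReal ^ ((1 : ℝ) / 2) /
    (∫ u, (supp K u - ⟪e, (u : EuclideanSpace ℝ (Fin n))⟫) ^ (-2 : ℝ) ∂(sphMeasure n))
      ^ ((1 : ℝ) / 2)

open scoped ENNReal

lemma bm1_compact (A B C : Set ℝ) (hA : IsCompact A) (hB : IsCompact B) (hA0 : A.Nonempty)
    (hB0 : B.Nonempty) (h : ∀ a ∈ A, ∀ b ∈ B, (a + b) / 2 ∈ C) :
    volume A + volume B ≤ 2 * volume C := by
  obtain ⟨a1, ha1, hamax⟩ := hA.exists_isGreatest hA0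
  obtain ⟨b0, hb0, hbmin⟩ := hB.exists_isLeast hB0
  have e1 : volume ((fun x => b0 + x) '' A) = volume A := by simp
  have e2 : volume ((fun x => a1 + x) '' B) = volume B := by simp
  have hd : volume (((fun x => b0 + x) '' A) ∩ ((fun x => a1 + x) '' B)) = 0 := by
    refine measure_mono_null (t := {a1 + b0}) ?_ (by simp)
    rintro x ⟨⟨a, ha, rfl⟩, ⟨b, hb, hab⟩⟩
    have := hamax ha
    have := hbmin hb
    simp only [mem_singleton_iff] at *
    linarith
  have hm : MeasurableSet ((fun x => a1 + x) '' B) :=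
    (hB.image (by fun_prop)).measurableSet
  have hu : volume (((fun x => b0 + x) '' A) ∪ ((fun x => a1 + x) '' B)) = volume A + volume B := by
    rw [← e1, ← e2]
    exact measure_union₀ hm.nullMeasurableSet hd
  rw [← hu]
  calc _ ≤ volume ((2:ℝ) • C) := by
        apply measure_mono
        rintro x (⟨a, ha, rfl⟩ | ⟨b, hb, rfl⟩)
        · refine ⟨_, h a ha b0 hb0, ?_⟩
          simp; ring
        · refine ⟨_, h a1 ha1 b hb, ?_⟩
          simp; ring
    _ = 2 * volume C := by
        rw [Measure.addHaar_smul]; simp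

lemma bm1 (A B C : Set ℝ) (hA : MeasurableSet A) (hB : MeasurableSet B) (hA0 : A.Nonempty)
    (hB0 : B.Nonempty) (h : ∀ a ∈ A, ∀ b ∈ B, (a + b) / 2 ∈ C) :
    volume A + volume B ≤ 2 * volume C := by
  have key : ∀ S : Set ℝ, MeasurableSet S →
      volume S = ⨆ (K : Set ℝ) (_ : K ⊆ S ∧ IsCompact K), volume K := by
    intro S hS
    rw [hS.measure_eq_iSup_isCompact]
    simp only [iSup_and]
  rw [key A hA, key B hB]
  refine ENNReal.biSup_add_biSup_le' ⟨∅, by simp⟩ ⟨∅, by simp⟩ ?_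
  rintro A' ⟨hA's, hA'c⟩ B' ⟨hB's, hB'c⟩
  obtain ⟨a, ha⟩ := hA0
  obtain ⟨b, hb⟩ := hB0
  calc _ ≤ volume (insert a A') + volume (insert b B') := by
        gcongr <;> exact subset_insert _ _
    _ ≤ _ := by
        apply bm1_compact _ _ _ (hA'c.insert a) (hB'c.insert b) (by simp) (by simp)
        intro x hx y hy
        exact h x (insert_subset ha hA's hx) y (insert_subset hb hB's hy)

lemma pl_norm (F G H : ℝ → ℝ) (hF : Measurable F) (hG : Measurable G) (hH : Measurable H)
    (hF0 : ∀ x, 0 ≤ F x) (hG0 : ∀ x, 0 ≤ G x) (hH0 : ∀ x, 0 ≤ H x)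
    (hF1 : ∀ x, F x ≤ 1) (hG1 : ∀ x, G x ≤ 1)
    (hFs : ∀ t < 1, ∃ x, t < F x) (hGs : ∀ t < 1, ∃ x, t < G x)
    (h : ∀ a b, F a * G b ≤ H ((a + b) / 2) ^ 2) :
    (∫⁻ x, ENNReal.ofReal (F x)) + (∫⁻ x, ENNReal.ofReal (G x))
      ≤ 2 * ∫⁻ x, ENNReal.ofReal (H x) := by
  rw [lintegral_eq_lintegral_meas_lt volume (ae_of_all _ hF0) hF.aemeasurable,
    lintegral_eq_lintegral_meas_lt volume (ae_of_all _ hG0) hG.aemeasurable,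
    lintegral_eq_lintegral_meas_lt volume (ae_of_all _ hH0) hH.aemeasurable]
  rw [← lintegral_add_left, ← lintegral_const_mul' _ _ (by simp)]
  · refine setLIntegral_mono' measurableSet_Ioi ?_
    intro t ht
    simp only [mem_Ioi] at ht
    by_cases ht1 : t < 1
    · apply bm1 _ _ _ (measurableSet_lt measurable_const hF) (measurableSet_lt measurable_const hG)
        (hFs t ht1) (hGs t ht1)
      intro a ha b hb
      simp only [mem_ofPred_eq] at *
      have := h a b
      have : t * t < F a * G b := by gcongr
      nlinarith [hH0 ((a+b)/2)]
    · have : {a | t < F a} = ∅ := by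
        ext x; simp; linarith [hF1 x]
      have : {a | t < G a} = ∅ := by
        ext x; simp; linarith [hG1 x]
      simp [*]
  · apply Antitone.measurable
    intro s t hst
    apply measure_mono
    intro x hx
    exact lt_of_le_of_lt hst hx

lemma amgm_enn (x y z : ℝ≥0∞) (h : x + y ≤ 2 * z) : x * y ≤ z ^ 2 := by
  rcases eq_or_ne z ∞ with rfl | hz
  · simp
  have hx : x ≠ ∞ := by
    rintro rfl
    simp [ENNReal.mul_eq_top, hz] at h
  have hy : y ≠ ∞ := by
    rintro rfl
    simp [ENNReal.mul_eq_top, hz] at h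
  lift x to NNReal using hx
  lift y to NNReal using hy
  lift z to NNReal using hz
  norm_cast at *
  have h' : (x : ℝ) + y ≤ 2 * z := by exact_mod_cast h
  have : (x : ℝ) * y ≤ z ^ 2 := by nlinarith [sq_nonneg ((x:ℝ) - y), x.2, y.2, z.2, sq_nonneg ((x:ℝ)+y)]
  exact_mod_cast this

lemma pl_real (F G H : ℝ → ℝ) (hF : Measurable F) (hG : Measurable G) (hH : Measurable H)
    (hF0 : ∀ x, 0 ≤ F x) (hG0 : ∀ x, 0 ≤ G x) (hH0 : ∀ x, 0 ≤ H x)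
    (hFb : BddAbove (range F)) (hGb : BddAbove (range G))
    (hFp : ∃ x, 0 < F x) (hGp : ∃ x, 0 < G x)
    (h : ∀ a b, F a * G b ≤ H ((a + b) / 2) ^ 2) :
    (∫⁻ x, ENNReal.ofReal (F x)) * (∫⁻ x, ENNReal.ofReal (G x))
      ≤ (∫⁻ x, ENNReal.ofReal (H x)) ^ 2 := by
  set M := sSup (range F) with hM
  set N := sSup (range G) with hN
  have hFM : ∀ x, F x ≤ M := fun x => le_csSup hFb (mem_range_self x)
  have hGN : ∀ x, G x ≤ N := fun x => le_csSup hGb (mem_range_self x)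
  have hM0 : 0 < M := by obtain ⟨x, hx⟩ := hFp; exact hx.trans_le (hFM x)
  have hN0 : 0 < N := by obtain ⟨x, hx⟩ := hGp; exact hx.trans_le (hGN x)
  have key := pl_norm (fun x => M⁻¹ * F x) (fun x => N⁻¹ * G x)
    (fun x => (√(M * N))⁻¹ * H x) (by fun_prop) (by fun_prop) (by fun_prop)
    (fun x => mul_nonneg (by positivity) (hF0 x)) (fun x => mul_nonneg (by positivity) (hG0 x))
    (fun x => mul_nonneg (by positivity) (hH0 x))
    (fun x => by rw [inv_mul_le_iff₀ hM0]; simpa using hFM x)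
    (fun x => by rw [inv_mul_le_iff₀ hN0]; simpa using hGN x)
    (fun t ht => by
      obtain ⟨_, ⟨x, rfl⟩, hx⟩ := exists_lt_of_lt_csSup (range_nonempty F) (b := M * t)
        (by rw [← hM]; nlinarith)
      exact ⟨x, by rwa [lt_inv_mul_iff₀ hM0]⟩)
    (fun t ht => by
      obtain ⟨_, ⟨x, rfl⟩, hx⟩ := exists_lt_of_lt_csSup (range_nonempty G) (b := N * t)
        (by rw [← hN]; nlinarith)
      exact ⟨x, by rwa [lt_inv_mul_iff₀ hN0]⟩)
    (fun a b => by
      have h1 := h a b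
      have : (√(M*N))^2 = M * N := Real.sq_sqrt (by positivity)
      rw [mul_pow, inv_pow, this, mul_inv]
      calc _ = M⁻¹ * N⁻¹ * (F a * G b) := by ring
        _ ≤ _ := by gcongr)
  have key2 := amgm_enn _ _ _ key
  simp_rw [ENNReal.ofReal_mul (inv_nonneg.2 hM0.le), ENNReal.ofReal_mul (inv_nonneg.2 hN0.le),
    ENNReal.ofReal_mul (inv_nonneg.2 (Real.sqrt_nonneg (M*N)))] at key2
  rw [lintegral_const_mul _ (by fun_prop), lintegral_const_mul _ (by fun_prop),
    lintegral_const_mul _ (by fun_prop), mul_pow, mul_mul_mul_comm, ← ENNReal.ofReal_mul (by positivity),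
    ← ENNReal.ofReal_pow (by positivity), inv_pow, Real.sq_sqrt (by positivity), ← mul_inv] at key2
  rwa [ENNReal.mul_le_mul_iff_right] at key2
  · simp; positivity
  · simp

lemma pl_enn (F G : ℝ → ℝ≥0∞) (H : ℝ → ℝ) (hF : Measurable F) (hG : Measurable G)
    (hH : Measurable H) (hH0 : ∀ x, 0 ≤ H x) (D : ℝ) (hD : ∀ x, H x ≤ D)
    (h : ∀ a b, F a * G b ≤ ENNReal.ofReal (H ((a + b) / 2) ^ 2)) :
    (∫⁻ x, F x) * (∫⁻ x, G x) ≤ (∫⁻ x, ENNReal.ofReal (H x)) ^ 2 := by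
  by_cases hF1 : ∀ x, F x = 0
  · simp [hF1]
  by_cases hG1 : ∀ x, G x = 0
  · simp [hG1]
  push Not at hF1 hG1
  obtain ⟨a0, ha0⟩ := hF1
  obtain ⟨b0, hb0⟩ := hG1
  have hFt : ∀ x, F x ≠ ∞ := by
    intro x hx
    have := h x b0
    rw [hx, ENNReal.top_mul hb0] at this
    simp at this
  have hGt : ∀ x, G x ≠ ∞ := by
    intro x hx
    have := h a0 x
    rw [hx, ENNReal.mul_top ha0] at this
    simp at this
  have h' : ∀ a b, (F a).toReal * (G b).toReal ≤ H ((a + b) / 2) ^ 2 := by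
    intro a b
    rw [← ENNReal.toReal_mul]
    exact ENNReal.toReal_le_of_le_ofReal (by positivity) (h a b)
  have pa : 0 < (F a0).toReal := ENNReal.toReal_pos ha0 (hFt _)
  have pb : 0 < (G b0).toReal := ENNReal.toReal_pos hb0 (hGt _)
  have hDD : ∀ x, H x ^ 2 ≤ D ^ 2 := fun x => by
    have := hH0 x
    have := hD x
    gcongr
  have := pl_real (fun x => (F x).toReal) (fun x => (G x).toReal) H hF.ennreal_toReal
    hG.ennreal_toReal hH (by simp) (by simp) hH0
    ⟨D ^ 2 / (G b0).toReal, by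
      rintro _ ⟨x, rfl⟩
      rw [le_div_iff₀ pb]
      exact (h' _ _).trans (hDD _)⟩
    ⟨D ^ 2 / (F a0).toReal, by
      rintro _ ⟨x, rfl⟩
      rw [le_div_iff₀ pa, mul_comm]
      exact (h' _ _).trans (hDD _)⟩ ⟨a0, pa⟩ ⟨b0, pb⟩ h'
  simpa [ENNReal.ofReal_toReal, hFt, hGt] using this

lemma lint_exp (φ : ℝ → ℝ≥0∞) :
    ∫⁻ s in Ioi (0:ℝ), φ s = ∫⁻ a, ENNReal.ofReal (exp a) * φ (exp a) := by
  have := lintegral_image_eq_lintegral_abs_deriv_mul (s := univ) (f := exp) (f' := exp)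
    MeasurableSet.univ (fun x _ => (Real.hasDerivAt_exp x).hasDerivWithinAt)
    Real.exp_injective.injOn φ
  simpa [Real.range_exp] using this

lemma half_line (φ ψ : ℝ → ℝ≥0∞) (hφ : Measurable φ) (hψ : Measurable ψ)
    (h : ∀ s > 0, ∀ t > 0, φ s * ψ t ≤ ENNReal.ofReal (exp (-(s * t)))) :
    (∫⁻ s in Ioi (0:ℝ), φ s) * (∫⁻ s in Ioi (0:ℝ), ψ s) ≤ ENNReal.ofReal (π / 2) := by
  rw [lint_exp, lint_exp]
  have key := pl_enn (fun a => ENNReal.ofReal (exp a) * φ (exp a))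
    (fun a => ENNReal.ofReal (exp a) * ψ (exp a)) (fun c => exp c * exp (- (1/2) * (exp c) ^ 2))
    (by fun_prop) (by fun_prop) (by fun_prop) (fun x => by positivity) 1
    (fun x => by
      rw [← Real.exp_add, Real.exp_le_one_iff]
      nlinarith [Real.add_one_le_exp x, sq_nonneg (exp x - 1)])
    (fun a b => by
      have := h (exp a) (exp_pos a) (exp b) (exp_pos b)
      rw [mul_mul_mul_comm, ← ENNReal.ofReal_mul (by positivity)]
      calc _ ≤ ENNReal.ofReal (exp a * exp b) * ENNReal.ofReal (exp (-(exp a * exp b))) := by gcongr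
        _ = _ := by
          rw [← ENNReal.ofReal_mul (by positivity)]
          congr 1
          simp only [← Real.exp_nat_mul, ← Real.exp_add]
          congr 1
          push_cast
          have : (2:ℝ) * ((a+b)/2) = a + b := by ring
          rw [this]; ring)
  refine key.trans_eq ?_
  have e1 : ∀ c : ℝ, ENNReal.ofReal (exp c * exp (- (1/2) * (exp c) ^ 2)) =
      ENNReal.ofReal (exp c) * (fun r : ℝ => ENNReal.ofReal (exp (-(1/2) * r ^ 2))) (exp c) := by
    intro c
    rw [ENNReal.ofReal_mul (by positivity)]
  rw [lintegral_congr e1, ← lint_exp (fun r : ℝ => ENNReal.ofReal (exp (-(1/2) * r ^ 2))), ← ofReal_integral_eq_lintegral_ofReal, integral_gaussian_Ioi,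
    ← ENNReal.ofReal_pow (by positivity)]
  · congr 1
    rw [div_pow, Real.sq_sqrt (by positivity)]
    ring
  · exact (integrable_exp_neg_mul_sq (by norm_num)).integrableOn
  · exact ae_of_all _ (fun x => by positivity)

lemma half_line' (φ ψ : ℝ → ℝ≥0∞) (hφ : Measurable φ) (hψ : Measurable ψ) (a : ℝ) (ha : 0 < a)
    (h : ∀ s > 0, ∀ t > 0, φ s * ψ t ≤ ENNReal.ofReal (a * exp (-(s * t)))) :
    (∫⁻ s in Ioi (0:ℝ), φ s) * (∫⁻ s in Ioi (0:ℝ), ψ s) ≤ ENNReal.ofReal (π / 2 * a) := by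
  have h0 : ENNReal.ofReal a ≠ 0 := by simpa using ha
  have h1 : ENNReal.ofReal a ≠ ∞ := by simp
  have := half_line (fun s => (ENNReal.ofReal a)⁻¹ * φ s) ψ (by fun_prop) hψ (by
    intro s hs t ht
    have := h s hs t ht
    rw [ENNReal.ofReal_mul ha.le] at this
    rw [mul_assoc]
    exact (ENNReal.inv_mul_le_iff h0 h1).2 this)
  rw [lintegral_const_mul _ hφ, mul_assoc, ENNReal.inv_mul_le_iff h0 h1,
    ← ENNReal.ofReal_mul ha.le] at this
  rwa [mul_comm (π / 2)]

/-- Functional Santalo inequality for densities with barycenter at the origin. -/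
def SanP (E : Type*) [NormedAddCommGroup E] [NormedSpace ℝ E] [MeasureSpace E]
    (B : E → E → ℝ) (C : ℝ) : Prop :=
  ∀ (f g : E → ℝ≥0∞) (a : ℝ), 0 < a → Measurable f → Measurable g → (∫⁻ x, f x) ≠ ∞ →
    Integrable (fun x : E => x) (volume.withDensity f) →
    ∫ x, x ∂(volume.withDensity f) = 0 →
    (∀ x y, f x * g y ≤ ENNReal.ofReal (a * exp (-B x y))) →
    (∫⁻ x, f x) * (∫⁻ x, g x) ≤ ENNReal.ofReal (C * a)

section half
variable {E : Type*} [NormedAddCommGroup E] [NormedSpace ℝ E] [FiniteDimensional ℝ E]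
  [MeasureSpace E] [BorelSpace E] [(volume : Measure E).IsAddHaarMeasure]

lemma lint_sigma (σ : ℝ) (hσ : σ = 1 ∨ σ = -1) (h : ℝ → ℝ≥0∞) :
    ∫⁻ t in {t | 0 < σ * t}, h t = ∫⁻ t in Ioi (0:ℝ), h (σ * t) := by
  rcases hσ with rfl | rfl
  · simp only [one_mul]; rfl
  · rw [← lintegral_indicator measurableSet_Ioi,
      ← lintegral_indicator (measurableSet_lt measurable_const (by fun_prop)),
      ← lintegral_neg_eq_self]
    congr 1
    ext x
    simp [indicator]

lemma lint_shear (w : E) (g : ℝ × E → ℝ≥0∞) (hg : Measurable g) (σ : ℝ) (k : E → ℝ≥0∞)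
    (hk : Measurable k) :
    ∫⁻ y, k y * ∫⁻ t in {t | 0 < σ * t}, g (t, y + t • w)
      = ∫⁻ p in {p : ℝ × E | 0 < σ * p.1}, k (p.2 - p.1 • w) * g p := by
  have hs : MeasurableSet {t : ℝ | 0 < σ * t} := measurableSet_lt measurable_const (by fun_prop)
  have hS : MeasurableSet {p : ℝ × E | 0 < σ * p.1} :=
    measurableSet_lt measurable_const (by fun_prop)
  have e : ∀ y, k y * ∫⁻ t in {t | 0 < σ * t}, g (t, y + t • w)
      = ∫⁻ t, {t : ℝ | 0 < σ * t}.indicator (fun t => k y * g (t, y + t • w)) t := by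
    intro y
    rw [lintegral_indicator hs, lintegral_const_mul]
    exact hg.comp (by fun_prop)
  rw [lintegral_congr e, ← lintegral_indicator hS, lintegral_lintegral_swap]
  · rw [Measure.volume_eq_prod, lintegral_prod]
    · refine lintegral_congr fun t => ?_
      symm
      rw [← lintegral_add_right_eq_self _ (t • w)]
      refine lintegral_congr fun y => ?_
      by_cases h : 0 < σ * t <;> simp [indicator, h]
    · apply Measurable.aemeasurable
      apply Measurable.indicator _ hS
      exact (hk.comp (by fun_prop)).mul hg
  · apply Measurable.aemeasurable
    have : Function.uncurry (fun (y : E) (t : ℝ) =>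
        {t : ℝ | 0 < σ * t}.indicator (fun t => k y * g (t, y + t • w)) t)
        = {p : E × ℝ | 0 < σ * p.2}.indicator (fun p => k p.1 * g (p.2, p.1 + p.2 • w)) := by
      ext p
      simp [Function.uncurry, indicator]
    rw [this]
    apply Measurable.indicator _ (measurableSet_lt measurable_const (by fun_prop))
    exact (hk.comp measurable_fst).mul (hg.comp (by fun_prop))

lemma half_step (B : E →L[ℝ] E →L[ℝ] ℝ) (hB : ∀ x y, B x y = B y x) (C : ℝ)
    (hP : SanP E (fun x y => B x y) C) (σ : ℝ) (hσ : σ = 1 ∨ σ = -1) (w : E)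
    (g f : ℝ × E → ℝ≥0∞) (hg : Measurable g) (hf : Measurable f) (a : ℝ) (ha : 0 < a)
    (hgt : ∫⁻ p in {p : ℝ × E | 0 < σ * p.1}, g p ≠ ∞)
    (hi : Integrable (fun p : ℝ × E => p.2 - p.1 • w)
      ((volume.withDensity g).restrict {p : ℝ × E | 0 < σ * p.1}))
    (hi0 : ∫ p, (p.2 - p.1 • w)
      ∂((volume.withDensity g).restrict {p : ℝ × E | 0 < σ * p.1}) = 0)
    (h : ∀ p q, f p * g q ≤ ENNReal.ofReal (a * exp (-(p.1 * q.1 + B p.2 q.2)))) :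
    (∫⁻ p in {p : ℝ × E | 0 < σ * p.1}, g p) *
      (∫⁻ x, ∫⁻ s in {s | 0 < σ * s}, f (s - B w x, x)) ≤ ENNReal.ofReal (C * (π / 2 * a)) := by
  have hS : MeasurableSet {p : ℝ × E | 0 < σ * p.1} :=
    measurableSet_lt measurable_const (by fun_prop)
  set G : E → ℝ≥0∞ := fun y => ∫⁻ t in {t | 0 < σ * t}, g (t, y + t • w) with hG
  set F : E → ℝ≥0∞ := fun x => ∫⁻ s in {s | 0 < σ * s}, f (s - B w x, x) with hF
  have hGm : Measurable G := by
    apply Measurable.lintegral_prod_right'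
      (f := fun p : E × ℝ => g (p.2, p.1 + p.2 • w))
    exact hg.comp (by fun_prop)
  have hFm : Measurable F := by
    apply Measurable.lintegral_prod_right'
      (f := fun p : E × ℝ => f (p.2 - B w p.1, p.1))
    exact hf.comp (by fun_prop)
  have hGint : ∫⁻ y, G y = ∫⁻ p in {p : ℝ × E | 0 < σ * p.1}, g p := by
    simpa using lint_shear w g hg σ (fun _ => 1) measurable_const
  have hmap : (volume.withDensity G) = Measure.map (fun p : ℝ × E => p.2 - p.1 • w)
      ((volume.withDensity g).restrict {p : ℝ × E | 0 < σ * p.1}) := by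
    ext S hSm
    have hmeas : Measurable (fun p : ℝ × E => p.2 - p.1 • w) := by fun_prop
    rw [withDensity_apply _ hSm, Measure.map_apply hmeas hSm,
      Measure.restrict_apply (hmeas hSm), withDensity_apply _ ((hmeas hSm).inter hS)]
    have := lint_shear w g hg σ (S.indicator 1) (measurable_one.indicator hSm)
    rw [← lintegral_indicator hSm, ← Measure.restrict_restrict (hmeas hSm),
      ← lintegral_indicator (hmeas hSm)]
    trans ∫⁻ y, S.indicator 1 y * ∫⁻ t in {t | 0 < σ * t}, g (t, y + t • w)
    · refine lintegral_congr fun y => ?_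
      by_cases hy : y ∈ S <;> simp [indicator, hy, hG]
    · rw [this]
      refine lintegral_congr fun p0 => ?_
      obtain ⟨p, q⟩ := p0
      by_cases hy : q - p • w ∈ S <;> simp [indicator, hy]
  have key := hP G F (π / 2 * a) (by positivity) hGm hFm (by rwa [hGint])
    (by
      rw [hmap, integrable_map_measure (by fun_prop) (by fun_prop)]
      exact hi)
    (by
      rw [hmap, integral_map (by fun_prop) (by fun_prop)]
      exact hi0)
    (by
      intro y x
      simp only [hG, hF]
      rw [lint_sigma σ hσ, lint_sigma σ hσ]
      have hσσ : σ * σ = 1 := by rcases hσ with rfl | rfl <;> norm_num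
      refine (half_line' (fun t => g (σ * t, y + (σ * t) • w)) (fun s => f (σ * s - B w x, x))
        (hg.comp (by fun_prop)) (hf.comp (by fun_prop)) (a * exp (-(B y x)))
        (by positivity) ?_).trans_eq (by rw [mul_assoc])
      intro s hs t ht
      rw [mul_comm]
      refine (h _ _).trans_eq ?_
      rw [mul_assoc a, ← Real.exp_add]
      congr 3
      simp only [map_add, map_smul, smul_eq_mul]
      rw [hB x y, hB x w]
      linear_combination (-(s * t)) * hσσ)
  rwa [hGint] at key
end half

lemma bisect (ν : Measure ℝ) [IsFiniteMeasure ν] [NullSingletonClass ν] : ∃ c, ν (Iio c) = ν (Ioi c) := by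
  by_cases hν : ν = 0
  · exact ⟨0, by simp [hν]⟩
  have hT : 0 < ν.real univ := by
    rw [measureReal_def]
    exact ENNReal.toReal_pos (by simpa using hν) (by simp)
  have hcont : Continuous (fun c => ν.real (Iic c)) := by
    have h1 := (integrable_const (μ := ν) (1:ℝ)).continuous_primitive 0
    have : (fun c => ν.real (Iic c)) = fun c => ν.real (Iic 0) + ∫ x in (0:ℝ)..c, (1:ℝ) ∂ν := by
      ext c
      rw [← intervalIntegral.integral_Iic_sub_Iic (integrable_const _).integrableOn
        (integrable_const _).integrableOn]
      simp
    rw [this]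
    exact continuous_const.add h1
  have hsplit : ∀ c, ν.real (Iic c) + ν.real (Ioi c) = ν.real univ := by
    intro c
    have := measureReal_add_measureReal_compl (μ := ν) (measurableSet_Iic (a := c))
    rwa [compl_Iic] at this
  have hhi : ∃ c, ν.real univ / 2 ≤ ν.real (Iic c) := by
    have h1 := (ENNReal.tendsto_toReal (measure_ne_top ν univ)).comp (tendsto_measure_Iic_atTop ν)
    have h2 := h1.eventually (lt_mem_nhds (show ν.real univ / 2 < (ν univ).toReal by
      rw [measureReal_def] at hT ⊢; linarith))
    obtain ⟨c, hc⟩ := h2.exists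
    exact ⟨c, hc.le⟩
  have hlo : ∃ c, ν.real (Iic c) ≤ ν.real univ / 2 := by
    have h1 := (ENNReal.tendsto_toReal (measure_ne_top ν univ)).comp (tendsto_measure_Ici_atBot ν)
    have h2 := h1.eventually (lt_mem_nhds (show ν.real univ / 2 < (ν univ).toReal by
      rw [measureReal_def] at hT ⊢; linarith))
    obtain ⟨c, hc⟩ := h2.exists
    have h3 : ν.real (Ici c) = ν.real (Ioi c) := measureReal_congr Ioi_ae_eq_Ici.symm
    have h4 := hsplit c
    have h5 : ν.real univ / 2 < ν.real (Ici c) := hc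
    exact ⟨c, by linarith⟩
  obtain ⟨lo, hlo⟩ := hlo
  obtain ⟨hi, hhi⟩ := hhi
  obtain ⟨c, hc⟩ := mem_range_of_exists_le_of_exists_ge hcont ⟨lo, hlo⟩ ⟨hi, hhi⟩
  refine ⟨c, ?_⟩
  have h3 : ν (Iio c) = ν (Iic c) := measure_congr Iio_ae_eq_Iic
  rw [h3, ← ENNReal.toReal_eq_toReal_iff' (by simp) (by simp)]
  have := hsplit c
  simp only [measureReal_def] at *
  linarith

section step
variable {E : Type*} [NormedAddCommGroup E] [NormedSpace ℝ E] [FiniteDimensional ℝ E]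
  [MeasureSpace E] [BorelSpace E] [(volume : Measure E).IsAddHaarMeasure]

/-- existence of the good centre -/
lemma exists_center (ν : Measure (ℝ × E)) [IsFiniteMeasure ν] (hac : ν ≪ volume) (hν : ν ≠ 0)
    (hi : Integrable (fun p : ℝ × E => p) ν) :
    ∃ (z : ℝ × E) (w : E), ν {p | 0 < -1 * (p.1 - z.1)} = ν univ / 2 ∧
      ν {p | 0 < 1 * (p.1 - z.1)} = ν univ / 2 ∧
      ∀ σ : ℝ, σ = 1 ∨ σ = -1 →
        ∫ p in {p | 0 < σ * (p.1 - z.1)}, ((p.2 - z.2) - (p.1 - z.1) • w) ∂ν = 0 := by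
  have hnull : ∀ c : ℝ, ν {p : ℝ × E | p.1 = c} = 0 := by
    intro c
    apply hac
    have : {p : ℝ × E | p.1 = c} = {c} ×ˢ univ := by ext; simp
    rw [this, Measure.volume_eq_prod, Measure.prod_prod]
    simp
  have hna : NullSingletonClass (Measure.map Prod.fst ν) := by
    constructor
    intro c
    rw [Measure.map_apply measurable_fst (measurableSet_singleton _)]
    exact hnull c
  obtain ⟨c, hc⟩ := bisect (Measure.map Prod.fst ν)
  rw [Measure.map_apply measurable_fst measurableSet_Iio,
    Measure.map_apply measurable_fst measurableSet_Ioi] at hc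
  have em : (Prod.fst ⁻¹' Iio c : Set (ℝ × E)) = {p | 0 < -1 * (p.1 - c)} := by
    ext p; simp
  have ep : (Prod.fst ⁻¹' Ioi c : Set (ℝ × E)) = {p | 0 < 1 * (p.1 - c)} := by
    ext p; simp
  rw [em, ep] at hc
  set Sm : Set (ℝ × E) := {p | 0 < -1 * (p.1 - c)} with hSm
  set Sp : Set (ℝ × E) := {p | 0 < 1 * (p.1 - c)} with hSp
  have hSmm : MeasurableSet Sm := measurableSet_lt measurable_const (by fun_prop)
  have hSpm : MeasurableSet Sp := measurableSet_lt measurable_const (by fun_prop)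
  have htot : ν univ = ν Sm + ν Sp := by
    rw [← measure_union _ hSpm]
    · symm
      apply measure_congr
      rw [ae_eq_univ]
      refine measure_mono_null ?_ (hnull c)
      intro p hp
      simp [hSm, hSp] at hp ⊢
      linarith
    · rw [disjoint_left]
      intro p hp hp'
      simp [hSm, hSp] at hp hp'
      linarith
  have hpv : ν Sp = ν univ / 2 := by
    rw [htot, hc, ← two_mul, mul_comm, ENNReal.mul_div_cancel_right (by simp) (by simp)]
  have hmv : ν Sm = ν univ / 2 := hc.trans hpv
  have hu0 : ν univ ≠ 0 := by simpa using hν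
  have hp0 : ν Sp ≠ 0 := by rw [hpv]; simp [ENNReal.div_eq_zero_iff, hν]
  have hm0 : ν Sm ≠ 0 := by rwa [hc]
  have hi1 : Integrable (fun p : ℝ × E => p.1) ν := hi.fst
  have hi2 : Integrable (fun p : ℝ × E => p.2) ν := hi.snd
  have hi1c : Integrable (fun p : ℝ × E => p.1 - c) ν := hi1.sub (integrable_const c)
  set m := ν.real Sp with hm
  have hm' : ν.real Sm = m := by rw [hm, measureReal_def, hc]; rfl
  have hmpos : 0 < m := ENNReal.toReal_pos hp0 (by simp)
  set Tp := ∫ p in Sp, (p.1 - c) ∂ν with hTp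
  set Tm := ∫ p in Sm, (p.1 - c) ∂ν with hTm
  set Yp := ∫ p in Sp, p.2 ∂ν with hYp
  set Ym := ∫ p in Sm, p.2 ∂ν with hYm
  have hTp0 : 0 < Tp := by
    rw [hTp, setIntegral_pos_iff_support_of_nonneg_ae _ hi1c.integrableOn]
    · rw [pos_iff_ne_zero]
      convert hp0 using 2
      ext p
      simp [hSp]
      intro h h2; linarith
    · filter_upwards [ae_restrict_mem hSpm] with p hp
      simp [hSp] at hp ⊢
      exact hp.le
  have hTm0 : Tm < 0 := by
    have : 0 < ∫ p in Sm, -(p.1 - c) ∂ν := by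
      rw [setIntegral_pos_iff_support_of_nonneg_ae (f := fun p : ℝ × E => -(p.1 - c)) _ hi1c.neg.integrableOn]
      · rw [pos_iff_ne_zero]
        convert hm0 using 2
        ext p
        simp [hSm]
        intro h h2; linarith
      · filter_upwards [ae_restrict_mem hSmm] with p hp
        simp [hSm] at hp ⊢
        exact hp.le
    rw [integral_neg] at this
    linarith
  set w : E := (Tp - Tm)⁻¹ • (Yp - Ym) with hw
  have hww : (Tp - Tm) • w = Yp - Ym := by
    rw [hw, smul_inv_smul₀]; linarith
  set z' : E := m⁻¹ • (Yp - Tp • w) with hz'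
  have hzz : m • z' = Yp - Tp • w := by
    rw [hz', smul_inv_smul₀ hmpos.ne']
  have hintg : ∀ S : Set (ℝ × E), MeasurableSet S → ν.real S = m →
      ∫ p in S, ((p.2 - z') - (p.1 - c) • w) ∂ν
        = (∫ p in S, p.2 ∂ν) - m • z' - (∫ p in S, (p.1 - c) ∂ν) • w := by
    intro S hS hSm
    rw [integral_sub, integral_sub, integral_smul_const (fun p : ℝ × E => p.1 - c) w,
      setIntegral_const, hSm]
    · exact hi2.integrableOn
    · exact integrable_const _
    · exact hi2.integrableOn.sub (integrable_const _)
    · exact (hi1c.integrableOn (s := S)).smul_const w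
  refine ⟨(c, z'), w, hmv, hpv, ?_⟩
  rintro σ (rfl | rfl)
  · change ∫ p in Sp, ((p.2 - z') - (p.1 - c) • w) ∂ν = 0
    rw [hintg Sp hSpm rfl, hzz]
    simp [← hYp, ← hTp]
  · change ∫ p in Sm, ((p.2 - z') - (p.1 - c) • w) ∂ν = 0
    rw [hintg Sm hSmm hm', hzz, ← hYm, ← hTm]
    rw [sub_smul] at hww
    have : Yp = Tp • w - Tm • w + Ym := by rw [hww]; abel
    rw [this]; abel
end step

section step
variable {E : Type*} [NormedAddCommGroup E] [NormedSpace ℝ E] [FiniteDimensional ℝ E]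
  [MeasureSpace E] [BorelSpace E] [(volume : Measure E).IsAddHaarMeasure]

instance volProdHaar : (volume : Measure (ℝ × E)).IsAddHaarMeasure :=
  inferInstanceAs (((volume : Measure ℝ).prod (volume : Measure E)).IsAddHaarMeasure)

lemma withDensity_translate {V : Type*} [NormedAddCommGroup V] [NormedSpace ℝ V]
    [FiniteDimensional ℝ V] [MeasureSpace V]
    [BorelSpace V] [(volume : Measure V).IsAddHaarMeasure] (g : V → ℝ≥0∞) (z : V) :
    (volume.withDensity (fun p => g (z + p)) : Measure V)
      = Measure.map (fun p => p - z) (volume.withDensity g) := by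
  ext S hS
  have hm : Measurable (fun p : V => p - z) := by fun_prop
  rw [withDensity_apply _ hS, Measure.map_apply hm hS, withDensity_apply _ (hm hS),
    ← lintegral_indicator hS, ← lintegral_indicator (hm hS)]
  symm
  rw [← lintegral_add_left_eq_self _ z]
  refine lintegral_congr fun p => ?_
  by_cases hp : p ∈ S <;> simp [indicator, hp]

lemma sum_F (f : ℝ × E → ℝ≥0∞) (hf : Measurable f) (ℓ : E →L[ℝ] ℝ) :
    (∫⁻ x, ∫⁻ s in {s : ℝ | 0 < 1 * s}, f (s - ℓ x, x)) +
      (∫⁻ x, ∫⁻ s in {s : ℝ | 0 < -1 * s}, f (s - ℓ x, x)) = ∫⁻ p, f p := by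
  rw [← lintegral_add_left, Measure.volume_eq_prod, lintegral_prod_symm _ hf.aemeasurable]
  · refine lintegral_congr fun x => ?_
    have e1 : {s : ℝ | 0 < 1 * s} = Ioi 0 := by ext; simp
    have e2 : {s : ℝ | 0 < -1 * s} = Iio 0 := by ext; simp
    rw [e1, e2, setLIntegral_congr Iio_ae_eq_Iic, ← compl_Ioi,
      lintegral_add_compl _ measurableSet_Ioi]
    exact lintegral_sub_right_eq_self (fun s => f (s, x)) (ℓ x)
  · apply Measurable.lintegral_prod_right'
      (f := fun p : E × ℝ => f (p.2 - ℓ p.1, p.1))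
    exact hf.comp (by fun_prop)

lemma san_exists (B : E →L[ℝ] E →L[ℝ] ℝ) (hB : ∀ x y, B x y = B y x) (C : ℝ) (hC : 0 ≤ C)
    (hP : SanP E (fun x y => B x y) C) (g : ℝ × E → ℝ≥0∞) (hg : Measurable g)
    (hgt : ∫⁻ p, g p ≠ ∞) (hi : Integrable (fun p : ℝ × E => p) (volume.withDensity g)) :
    ∃ z : ℝ × E, ∀ (f : ℝ × E → ℝ≥0∞) (a : ℝ), Measurable f → 0 < a →
      (∀ p q, f p * g (z + q) ≤ ENNReal.ofReal (a * exp (-(p.1 * q.1 + B p.2 q.2)))) →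
      (∫⁻ p, f p) * (∫⁻ p, g p) ≤ ENNReal.ofReal (2 * π * C * a) := by
  set ν : Measure (ℝ × E) := volume.withDensity g with hν
  have htot : ν univ = ∫⁻ p, g p := by simp [hν]
  have : IsFiniteMeasure ν := ⟨by rw [htot]; exact hgt.lt_top⟩
  by_cases h0 : ν = 0
  · refine ⟨0, fun f a _ _ _ => ?_⟩
    rw [← htot, h0]
    simp
  obtain ⟨z, w, hzm, hzp, hz⟩ := exists_center ν (withDensity_absolutelyContinuous _ _) h0 hi
  refine ⟨z, fun f a hf ha h => ?_⟩
  set g' : ℝ × E → ℝ≥0∞ := fun p => g (z + p) with hg'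
  have hg'm : Measurable g' := hg.comp (by fun_prop)
  have hS : ∀ σ : ℝ, MeasurableSet {p : ℝ × E | 0 < σ * p.1} := fun σ =>
    measurableSet_lt measurable_const (by fun_prop)
  have hmm : Measurable (fun p : ℝ × E => p - z) := by fun_prop
  have hmap : (volume.withDensity g' : Measure (ℝ × E)) = Measure.map (fun p => p - z) ν :=
    withDensity_translate g z
  have hrestr : ∀ σ : ℝ, (volume.withDensity g').restrict {p : ℝ × E | 0 < σ * p.1}
      = Measure.map (fun p => p - z) (ν.restrict {p | 0 < σ * (p.1 - z.1)}) := by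
    intro σ
    rw [hmap, Measure.restrict_map hmm (hS σ)]
    rfl
  have hhalf : ∀ σ : ℝ, σ = 1 ∨ σ = -1 → ∫⁻ p in {p : ℝ × E | 0 < σ * p.1}, g' p = ν univ / 2 := by
    intro σ hσ
    rw [← withDensity_apply _ (hS σ), hmap, Measure.map_apply hmm (hS σ)]
    rcases hσ with rfl | rfl
    · exact hzp
    · exact hzm
  have key : ∀ σ : ℝ, σ = 1 ∨ σ = -1 → ν univ / 2 *
      (∫⁻ x, ∫⁻ s in {s | 0 < σ * s}, f (s - B w x, x)) ≤ ENNReal.ofReal (C * (π / 2 * a)) := by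
    intro σ hσ
    have hh := half_step B hB C hP σ hσ w g' f hg'm hf a ha
      (by rw [hhalf σ hσ, htot]; exact ENNReal.div_ne_top hgt (by simp))
      (by
        rw [hrestr, integrable_map_measure (by fun_prop) (by fun_prop)]
        have hi1 : Integrable (fun p : ℝ × E => p.1) ν := hi.fst
        have hi2 : Integrable (fun p : ℝ × E => p.2) ν := hi.snd
        exact ((hi2.sub (integrable_const z.2)).sub
          ((hi1.sub (integrable_const z.1)).smul_const w)).integrableOn)
      (by
        rw [hrestr, integral_map (by fun_prop) (by fun_prop)]
        exact hz σ hσ) h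
    rwa [hhalf σ hσ] at hh
  have k1 := key 1 (Or.inl rfl)
  have k2 := key (-1) (Or.inr rfl)
  have k3 := add_le_add k1 k2
  rw [← mul_add, sum_F f hf (B w), ← ENNReal.ofReal_add (by positivity) (by positivity)] at k3
  rw [← htot]
  calc (∫⁻ p, f p) * ν univ = 2 * (ν univ / 2 * ∫⁻ p, f p) := by
        rw [← mul_assoc, ENNReal.mul_div_cancel (by simp) (by simp), mul_comm]
    _ ≤ 2 * ENNReal.ofReal (C * (π / 2 * a) + C * (π / 2 * a)) := by gcongr
    _ = _ := by
        rw [show (2 : ℝ≥0∞) = ENNReal.ofReal 2 by simp, ← ENNReal.ofReal_mul (by norm_num)]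
        congr 1; ring

lemma trunc_exists {V : Type*} [NormedAddCommGroup V] [NormedSpace ℝ V]
    [FiniteDimensional ℝ V] [MeasureSpace V]
    [BorelSpace V] [(volume : Measure V).IsAddHaarMeasure] (g : V → ℝ≥0∞) (hg : Measurable g) :
    ∃ G : ℕ → V → ℝ≥0∞, (∀ k, Measurable (G k)) ∧ (∀ k x, G k x ≤ g x) ∧
      (∀ k, ∫⁻ x, G k x ≠ ∞) ∧ (∀ k, Integrable (fun x : V => x) (volume.withDensity (G k))) ∧
      Filter.Tendsto (fun k => ∫⁻ x, G k x) Filter.atTop (nhds (∫⁻ x, g x)) := by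
  set G : ℕ → V → ℝ≥0∞ := fun k => (closedBall (0:V) k).indicator (fun x => min (g x) k) with hG
  have hGm : ∀ k, Measurable (G k) := fun k =>
    (hg.min measurable_const).indicator measurableSet_closedBall
  have hGt : ∀ k, ∫⁻ x, G k x ≠ ∞ := by
    intro k
    rw [hG, lintegral_indicator measurableSet_closedBall]
    refine ne_top_of_le_ne_top (b := ∫⁻ x in closedBall (0:V) k, (k : ℝ≥0∞)) ?_
      (lintegral_mono fun x => min_le_right _ _)
    rw [setLIntegral_const]
    exact ENNReal.mul_ne_top (by simp) measure_closedBall_lt_top.ne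
  refine ⟨G, hGm, ?_, hGt, ?_, ?_⟩
  · intro k x
    by_cases hx : x ∈ closedBall (0:V) k <;> simp only [hG, indicator, hx] <;> simp
  · intro k
    have : IsFiniteMeasure ((volume : Measure V).withDensity (G k)) :=
      ⟨by rw [withDensity_apply _ MeasurableSet.univ]; simpa using (hGt k).lt_top⟩
    refine Integrable.of_bound (by fun_prop) k ?_
    rw [ae_withDensity_iff (hGm k)]
    refine ae_of_all _ fun x hx => ?_
    by_contra hc
    apply hx
    simp only [hG]
    apply indicator_of_notMem
    simpa using hc
  · apply lintegral_tendsto_of_tendsto_of_monotone (fun k => (hGm k).aemeasurable)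
    · refine ae_of_all _ fun x i j hij => ?_
      simp only [hG]
      have hij' : (i : ℝ) ≤ j := by exact_mod_cast hij
      have hij'' : (i : ℝ≥0∞) ≤ j := by exact_mod_cast hij
      have hmin : min (g x) (i : ℝ≥0∞) ≤ min (g x) j := min_le_min le_rfl hij''
      refine (indicator_le_indicator (g := fun x => min (g x) (j : ℝ≥0∞)) hmin).trans ?_
      exact indicator_le_indicator_of_subset (closedBall_subset_closedBall hij') (by simp) x
    · refine ae_of_all _ fun x => ?_
      have h1 : Filter.Tendsto (fun k : ℕ => min (g x) (k : ℝ≥0∞)) Filter.atTop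
          (nhds (min (g x) ∞)) := tendsto_const_nhds.min ENNReal.tendsto_nat_nhds_top
      rw [min_top_right] at h1
      refine h1.congr' ?_
      obtain ⟨N, hN⟩ := exists_nat_ge ‖x‖
      filter_upwards [Filter.eventually_ge_atTop N] with k hk
      have : ‖x‖ ≤ k := hN.trans (by exact_mod_cast hk)
      simp only [hG]
      rw [indicator_of_mem]
      simpa using this

theorem san_step (B : E →L[ℝ] E →L[ℝ] ℝ) (hB : ∀ x y, B x y = B y x) (C : ℝ) (hC : 0 ≤ C)
    (hP : SanP E (fun x y => B x y) C) :
    SanP (ℝ × E) (fun p q => p.1 * q.1 + B p.2 q.2) (2 * π * C) := by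
  intro f g a ha hf hg hft hfi hf0 h
  obtain ⟨G, hGm, hGg, hGt, hGi, hlim⟩ := trunc_exists g hg
  refine le_of_tendsto' (ENNReal.Tendsto.const_mul hlim (Or.inr hft)) fun k => ?_
  obtain ⟨z, hz⟩ := san_exists B hB C hC hP (G k) (hGm k) (hGt k) (hGi k)
  set L : ℝ × E → ℝ := fun p => p.1 * z.1 + B p.2 z.2 with hL
  have hLm : Measurable L := by
    have : Continuous L := by
      have h2 : Continuous (fun p : ℝ × E => B p.2 z.2) := by fun_prop
      exact (by fun_prop : Continuous (fun p : ℝ × E => p.1 * z.1)).add h2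
    exact this.measurable
  have := hz (fun p => f p * ENNReal.ofReal (exp (L p))) a (by fun_prop) ha (by
    intro p q
    calc _ = f p * G k (z + q) * ENNReal.ofReal (exp (L p)) := by ring
      _ ≤ f p * g (z + q) * ENNReal.ofReal (exp (L p)) := by gcongr; exact hGg _ _
      _ ≤ ENNReal.ofReal (a * exp (-(p.1 * (z + q).1 + B p.2 (z + q).2))) *
            ENNReal.ofReal (exp (L p)) := by gcongr; exact h _ _
      _ = _ := by
        rw [← ENNReal.ofReal_mul (by positivity), mul_assoc, ← Real.exp_add]
        congr 3
        simp only [hL, Prod.fst_add, Prod.snd_add, map_add]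
        ring)
  refine le_trans ?_ this
  gcongr 1
  -- Jensen
  set ν : Measure (ℝ × E) := volume.withDensity f with hν
  have htot : ν univ = ∫⁻ p, f p := by simp [hν]
  have : IsFiniteMeasure ν := ⟨by rw [htot]; exact hft.lt_top⟩
  have e1 : ∫⁻ p, f p * ENNReal.ofReal (exp (L p)) = ∫⁻ p, ENNReal.ofReal (exp (L p)) ∂ν := by
    rw [hν, lintegral_withDensity_eq_lintegral_mul _ hf (by fun_prop)]
    rfl
  have hLi : Integrable L ν := by
    refine (hfi.fst.mul_const z.1).add ?_
    exact ((B.flip z.2).integrable_comp hfi.snd)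
  have hL0 : ∫ p, L p ∂ν = 0 := by
    have h1 : ∫ p, p.1 ∂ν = 0 := by
      have := (ContinuousLinearMap.fst ℝ ℝ E).integral_comp_comm hfi
      simpa [hf0] using this
    have h2 : ∫ p, B p.2 z.2 ∂ν = 0 := by
      have := ((B.flip z.2).comp (ContinuousLinearMap.snd ℝ ℝ E)).integral_comp_comm hfi
      simpa [hf0] using this
    have hBi : Integrable (fun p : ℝ × E => B p.2 z.2) ν :=
      (B.flip z.2).integrable_comp hfi.snd
    simp only [hL]
    rw [integral_add (hfi.fst.mul_const z.1) hBi,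
      integral_mul_const, h1, h2]
    simp
  rw [e1, ← htot]
  have e2 : ν.real univ = ∫ p, (1 + L p) ∂ν := by
    rw [integral_add (integrable_const _) hLi, hL0]
    simp
  rw [← ofReal_measureReal (by simp), e2]
  have hi1 : Integrable (fun p => 1 + L p) ν := (integrable_const _).add hLi
  calc ENNReal.ofReal (∫ p, (1 + L p) ∂ν) ≤ ENNReal.ofReal (∫ p, max (1 + L p) 0 ∂ν) := by
        refine ENNReal.ofReal_le_ofReal ?_
        exact integral_mono hi1 hi1.pos_part (fun p => le_max_left _ _)
    _ = ∫⁻ p, ENNReal.ofReal (max (1 + L p) 0) ∂ν :=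
        ofReal_integral_eq_lintegral_ofReal hi1.pos_part (ae_of_all _ fun p => le_max_right _ _)
    _ ≤ _ := by
        refine lintegral_mono fun p => ENNReal.ofReal_le_ofReal ?_
        refine max_le ?_ (exp_pos _).le
        linarith [Real.add_one_le_exp (L p)]
end step

lemma san_transfer {E E' : Type*} [NormedAddCommGroup E] [NormedSpace ℝ E] [FiniteDimensional ℝ E]
    [MeasureSpace E] [BorelSpace E] [NormedAddCommGroup E'] [NormedSpace ℝ E']
    [FiniteDimensional ℝ E'] [MeasureSpace E'] [BorelSpace E'] (e : E' ≃L[ℝ] E)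
    (he : MeasurePreserving e volume volume) (B : E → E → ℝ) (C : ℝ) (h : SanP E B C) :
    SanP E' (fun x y => B (e x) (e y)) C := by
  intro f g a ha hf hg hft hfi hf0 hfg
  have hem : Measurable e := e.continuous.measurable
  have hem' : Measurable e.symm := e.symm.continuous.measurable
  have hl : ∀ k : E' → ℝ≥0∞, Measurable k → ∫⁻ x, k (e.symm x) = ∫⁻ x, k x := by
    intro k hk
    rw [← he.map_eq, lintegral_map (show Measurable (fun x => k (e.symm x)) from hk.comp hem') hem]
    simp
  have hmap : (volume.withDensity (fun x => f (e.symm x)) : Measure E)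
      = Measure.map e (volume.withDensity f) := by
    ext S hS
    rw [withDensity_apply _ hS, Measure.map_apply hem hS, withDensity_apply _ (hem hS),
      ← lintegral_indicator hS, ← lintegral_indicator (hem hS),
      ← hl _ (hf.indicator (hem hS))]
    refine lintegral_congr fun p => ?_
    by_cases hp : p ∈ S <;> simp [indicator, hp]
  have key := h (fun x => f (e.symm x)) (fun x => g (e.symm x)) a ha (hf.comp hem') (hg.comp hem')
    (by rwa [hl f hf])
    (by
      rw [hmap, integrable_map_measure (by fun_prop) hem.aemeasurable]
      exact (e : E' →L[ℝ] E).integrable_comp hfi)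
    (by
      rw [hmap, integral_map hem.aemeasurable (by fun_prop)]
      have := (e : E' →L[ℝ] E).integral_comp_comm hfi
      rw [hf0] at this
      simpa using this)
    (by
      intro x y
      simpa using hfg (e.symm x) (e.symm y))
  rwa [hl f hf, hl g hg] at key

def consEquiv (n : ℕ) : EuclideanSpace ℝ (Fin (n + 1)) ≃L[ℝ] ℝ × EuclideanSpace ℝ (Fin n) :=
  LinearEquiv.toContinuousLinearEquiv
  { toFun := fun x => (x 0, WithLp.toLp 2 (fun i => x i.succ))
    invFun := fun p => WithLp.toLp 2 (Fin.cons p.1 (fun i => p.2 i))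
    map_add' := by intro x y; rfl
    map_smul' := by intro c x; rfl
    left_inv := by
      intro x
      ext i
      refine Fin.cases ?_ (fun j => ?_) i <;> simp
    right_inv := by
      intro p
      ext i <;> simp }

lemma consEquiv_mp (n : ℕ) : MeasurePreserving (consEquiv n) volume volume := by
  have h1 := EuclideanSpace.volume_preserving_symm_measurableEquiv_toLp (Fin (n+1))
  have h2 := volume_preserving_piFinSuccAbove (fun _ : Fin (n + 1) => ℝ) 0
  have h3 := (MeasurePreserving.id (volume : Measure ℝ)).prod
    (EuclideanSpace.volume_preserving_symm_measurableEquiv_toLp (Fin n)).symm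
  have := (h3.comp h2).comp h1
  have hfun : ⇑(consEquiv n) = ((Prod.map id ⇑(MeasurableEquiv.toLp 2 (Fin n → ℝ)).symm.symm ∘
      ⇑(MeasurableEquiv.piFinSuccAbove (fun _ => ℝ) 0)) ∘
      ⇑(MeasurableEquiv.toLp 2 (Fin (n + 1) → ℝ)).symm) := by
    ext x i
    · rfl
    · rfl
  rw [hfun]
  exact this

lemma consEquiv_fst (n : ℕ) (x : EuclideanSpace ℝ (Fin (n + 1))) : (consEquiv n x).1 = x 0 := rfl

lemma consEquiv_snd (n : ℕ) (x : EuclideanSpace ℝ (Fin (n + 1))) (i : Fin n) :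
    (consEquiv n x).2 i = x i.succ := rfl

lemma consEquiv_inner (n : ℕ) (x y : EuclideanSpace ℝ (Fin (n + 1))) :
    (consEquiv n x).1 * (consEquiv n y).1 + ⟪(consEquiv n x).2, (consEquiv n y).2⟫ = ⟪x, y⟫ := by
  simp only [PiLp.inner_apply, Fin.sum_univ_succ]
  simp [consEquiv_fst, consEquiv_snd, mul_comm]

theorem santalo_fun (n : ℕ) :
    SanP (EuclideanSpace ℝ (Fin n)) (fun x y => ⟪x, y⟫) ((2 * π) ^ n) := by
  induction n with
  | zero =>
    intro f g a ha hf hg hft hfi hf0 h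
    have := h 0 0
    rw [volume_euclideanSpace_eq_dirac]
    simpa using this
  | succ n ih =>
    have h1 := san_step (innerSL ℝ) (fun x y => real_inner_comm _ _) ((2 * π) ^ n) (by positivity) ih
    have h2 := san_transfer (consEquiv n) (consEquiv_mp n) _ _ h1
    convert h2 using 1
    · ext x y
      exact (consEquiv_inner n x y).symm
    · ring

lemma supp_bdd {n : ℕ} {K : Set (EuclideanSpace ℝ (Fin n))} (hK : IsCompact K)
    (y : EuclideanSpace ℝ (Fin n)) : BddAbove ((fun x => ⟪x, y⟫) '' K) :=
  (hK.image (by fun_prop)).bddAbove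

lemma le_supp {n : ℕ} {K : Set (EuclideanSpace ℝ (Fin n))} (hK : IsCompact K)
    {x : EuclideanSpace ℝ (Fin n)} (hx : x ∈ K) (y : EuclideanSpace ℝ (Fin n)) :
    ⟪x, y⟫ ≤ supp K y :=
  le_csSup (supp_bdd hK y) ⟨x, hx, rfl⟩

lemma supp_smul {n : ℕ} (K : Set (EuclideanSpace ℝ (Fin n)))
    {c : ℝ} (hc : 0 ≤ c) (y : EuclideanSpace ℝ (Fin n)) :
    supp K (c • y) = c * supp K y := by
  unfold supp
  have : (fun x => ⟪x, c • y⟫) '' K = c • ((fun x => ⟪x, y⟫) '' K) := by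
    rw [← image_smul, image_image]
    simp [inner_smul_right]
  rw [this, Real.sSup_smul_of_nonneg hc, smul_eq_mul]

lemma supp_cont {n : ℕ} {K : Set (EuclideanSpace ℝ (Fin n))} (hK : IsCompact K) :
    Continuous (supp K) := by
  unfold supp
  exact hK.continuous_sSup (f := fun y x => ⟪x, y⟫) (by unfold Function.HasUncurry.uncurry; fun_prop)

lemma supp_sub_pos {n : ℕ} {K : Set (EuclideanSpace ℝ (Fin n))} (hK : IsCompact K)
    {x : EuclideanSpace ℝ (Fin n)} (hx : x ∈ interior K) {y : EuclideanSpace ℝ (Fin n)}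
    (hy : y ≠ 0) : 0 < supp K y - ⟪x, y⟫ := by
  obtain ⟨r, hr, hb⟩ := Metric.isOpen_iff.1 isOpen_interior x hx
  have hyn : 0 < ‖y‖ := norm_pos_iff.2 hy
  have hmem : x + (r / 2 / ‖y‖) • y ∈ K := by
    apply interior_subset
    apply hb
    rw [mem_ball, dist_eq_norm, add_sub_cancel_left, norm_smul, Real.norm_of_nonneg (by positivity)]
    field_simp
    linarith
  have := le_supp hK hmem y
  rw [inner_add_left, inner_smul_left, real_inner_self_eq_norm_sq] at this
  have h2 : 0 < (r / 2 / ‖y‖) * ‖y‖ ^ 2 := by positivity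
  simp at this
  linarith

/-- the radial density -/
def rho (n : ℕ) : Measure ℝ :=
  (volume.restrict (Ioi 0)).withDensity (fun t => ENNReal.ofReal (t ^ (n + 1) * exp (-t ^ 2 / 2)))

lemma rad_int (q : ℕ) (b : ℝ) (hb : 0 < b) :
    ∫⁻ t in Ioi (0:ℝ), ENNReal.ofReal (t ^ q * exp (-b * t ^ 2))
      = ENNReal.ofReal (b ^ (-((q:ℝ) + 1) / 2) * (1 / 2) * Gamma (((q:ℝ) + 1) / 2)) := by
  have h := integral_rpow_mul_exp_neg_mul_rpow (p := 2) (q := q) (b := b) two_pos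
    (by have : (0:ℝ) ≤ q := by positivity
        linarith) hb
  have hi := integrableOn_rpow_mul_exp_neg_mul_sq (b := b) hb (s := q)
    (by have : (0:ℝ) ≤ q := by positivity
        linarith)
  rw [← h, ← ofReal_integral_eq_lintegral_ofReal]
  · congr 1
    refine setIntegral_congr_fun measurableSet_Ioi fun t ht => ?_
    simp
  · refine hi.congr_fun (fun t ht => ?_) measurableSet_Ioi
    simp
  · filter_upwards [ae_restrict_mem measurableSet_Ioi] with t ht
    have : (0:ℝ) < t := ht
    positivity

lemma rho_univ (n : ℕ) : rho n univ = ENNReal.ofReal (2 ^ ((n:ℝ) / 2) * Gamma ((n:ℝ) / 2 + 1)) := by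
  rw [rho, withDensity_apply _ MeasurableSet.univ, Measure.restrict_univ]
  have := rad_int (n + 1) (1/2) (by norm_num)
  convert this using 2
  · ext t; congr 3; ring
  · push_cast
    rw [show ((1:ℝ)/2) = 2⁻¹ by norm_num, Real.inv_rpow (by norm_num), ← Real.rpow_neg (by norm_num),
      show -(-((n:ℝ) + 1 + 1) / 2) = n / 2 + 1 by ring, Real.rpow_add (by norm_num), Real.rpow_one,
      show ((n:ℝ) + 1 + 1) / 2 = n / 2 + 1 by ring]
    ring

lemma rho_id (n : ℕ) : Integrable (fun t : ℝ => t) (rho n) := by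
  have hm : Measurable (fun t : ℝ => ENNReal.ofReal (t ^ (n + 1) * exp (-t ^ 2 / 2))) := by fun_prop
  refine ⟨by fun_prop, ?_⟩
  rw [hasFiniteIntegral_iff_enorm, rho, lintegral_withDensity_eq_lintegral_mul _ hm (by fun_prop)]
  have h := rad_int (n + 2) (1/2) (by norm_num)
  refine lt_of_eq_of_lt ?_ (h.trans_lt ENNReal.ofReal_lt_top)
  refine setLIntegral_congr_fun measurableSet_Ioi fun t ht => ?_
  have ht' : (0:ℝ) < t := ht
  simp only [Pi.mul_apply]
  rw [Real.enorm_eq_ofReal ht'.le, ← ENNReal.ofReal_mul (by positivity)]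
  congr 1
  rw [show -t^2/2 = -(1/2)*t^2 by ring]
  ring

/-- the function attached to a body `L` -/
def ff {n : ℕ} (L : Set (EuclideanSpace ℝ (Fin n))) (v : EuclideanSpace ℝ (Fin n)) : ℝ≥0∞ :=
  ∫⁻ t in Ioi (0:ℝ), ENNReal.ofReal (t * exp (-t ^ 2 / 2)) * L.indicator 1 (t⁻¹ • v)

lemma ff_meas_aux {n : ℕ} {L : Set (EuclideanSpace ℝ (Fin n))} (hL : MeasurableSet L) :
    Measurable (fun p : EuclideanSpace ℝ (Fin n) × ℝ =>
      ENNReal.ofReal (p.2 * exp (-p.2 ^ 2 / 2)) * L.indicator (1 : EuclideanSpace ℝ (Fin n) → ℝ≥0∞) (p.2⁻¹ • p.1)) := by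
  refine Measurable.mul (by fun_prop) ?_
  exact (measurable_one.indicator hL).comp (measurable_snd.inv.smul measurable_fst)

lemma ff_meas {n : ℕ} {L : Set (EuclideanSpace ℝ (Fin n))} (hL : MeasurableSet L) :
    Measurable (ff L) :=
  (ff_meas_aux hL).lintegral_prod_right'

lemma ff_map {n : ℕ} {L : Set (EuclideanSpace ℝ (Fin n))} (hL : MeasurableSet L) :
    volume.withDensity (ff L) = Measure.map (fun p : ℝ × EuclideanSpace ℝ (Fin n) => p.1 • p.2)
      ((rho n).prod (volume.restrict L)) := by
  ext S hS
  have hsm : Measurable (fun p : ℝ × EuclideanSpace ℝ (Fin n) => p.1 • p.2) := by fun_prop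
  have hm : Measurable (fun t : ℝ => ENNReal.ofReal (t ^ (n + 1) * exp (-t ^ 2 / 2))) := by fun_prop
  rw [withDensity_apply _ hS, Measure.map_apply hsm hS, Measure.prod_apply (hsm hS), rho,
    lintegral_withDensity_eq_lintegral_mul _ hm (measurable_measure_prodMk_left (hsm hS))]
  unfold ff
  rw [lintegral_lintegral_swap (ff_meas_aux hL).aemeasurable]
  refine setLIntegral_congr_fun measurableSet_Ioi fun t ht => ?_
  have ht' : (0:ℝ) < t := ht
  have hLt : MeasurableSet ((fun v : EuclideanSpace ℝ (Fin n) => t⁻¹ • v) ⁻¹' L) :=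
    (measurable_const_smul t⁻¹) hL
  simp only [Pi.mul_apply]
  rw [lintegral_const_mul _ (by
    exact (measurable_one.indicator hL).comp (measurable_const_smul t⁻¹))]
  have h1 : ∫⁻ v in S, L.indicator (1 : EuclideanSpace ℝ (Fin n) → ℝ≥0∞) (t⁻¹ • v)
      = volume (((fun v : EuclideanSpace ℝ (Fin n) => t⁻¹ • v) ⁻¹' L) ∩ S) := by
    rw [← Measure.restrict_apply hLt, ← lintegral_indicator_one hLt]
    rfl
  have h2 : (volume.restrict L) (Prod.mk t ⁻¹' ((fun p : ℝ × EuclideanSpace ℝ (Fin n) => p.1 • p.2) ⁻¹' S))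
      = volume ((fun v : EuclideanSpace ℝ (Fin n) => t • v) ⁻¹'
        (((fun v : EuclideanSpace ℝ (Fin n) => t⁻¹ • v) ⁻¹' L) ∩ S)) := by
    rw [Measure.restrict_apply (by
      exact (measurable_const_smul t) hS)]
    congr 1
    ext v
    simp [ht'.ne', and_comm]
  rw [h1, h2, Measure.addHaar_preimage_smul _ ht'.ne', ← mul_assoc, ← ENNReal.ofReal_mul (by positivity)]
  congr 2
  rw [finrank_euclideanSpace, Fintype.card_fin, abs_of_nonneg (by positivity)]
  field_simp
  ring

instance rho_finite (n : ℕ) : IsFiniteMeasure (rho n) :=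
  ⟨by rw [rho_univ]; exact ENNReal.ofReal_lt_top⟩

lemma ff_mass {n : ℕ} {L : Set (EuclideanSpace ℝ (Fin n))} (hL : MeasurableSet L) :
    ∫⁻ v, ff L v = rho n univ * volume L := by
  have := congrArg (fun μ => μ univ) (ff_map hL)
  rw [withDensity_apply _ MeasurableSet.univ, Measure.restrict_univ,
    Measure.map_apply (by fun_prop) MeasurableSet.univ, preimage_univ, ← univ_prod_univ,
    Measure.prod_prod, Measure.restrict_apply_univ] at this
  exact this

lemma ff_integrable {n : ℕ} {L : Set (EuclideanSpace ℝ (Fin n))} (hL : IsCompact L) :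
    Integrable (fun v => v) (volume.withDensity (ff L)) := by
  rw [ff_map hL.measurableSet, integrable_map_measure (by fun_prop) (by fun_prop)]
  exact (rho_id n).smul_prod (continuous_id.continuousOn.integrableOn_compact hL)

lemma ff_bary {n : ℕ} {L : Set (EuclideanSpace ℝ (Fin n))} (hL : IsCompact L)
    (h0 : ∫ v in L, v = 0) :
    ∫ v, v ∂(volume.withDensity (ff L)) = 0 := by
  rw [ff_map hL.measurableSet, integral_map (by fun_prop) (by fun_prop)]
  have := integral_prod_smul (𝕜 := ℝ) (μ := rho n) (ν := volume.restrict L) (fun t : ℝ => t) (fun v => v)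
  rw [this, h0, smul_zero]

lemma tail_int (τ : ℝ) (hτ : 0 ≤ τ) :
    ∫⁻ t in Ioi τ, ENNReal.ofReal (t * exp (-t ^ 2 / 2)) = ENNReal.ofReal (exp (-τ ^ 2 / 2)) := by
  have hd : ∀ x ∈ Ici τ, HasDerivAt (fun t : ℝ => -exp (-t ^ 2 / 2)) (x * exp (-x ^ 2 / 2)) x := by
    intro x _
    have h1 : HasDerivAt (fun t : ℝ => -t ^ 2 / 2) (-x) x := by
      have := ((hasDerivAt_pow 2 x).neg).div_const 2
      refine this.congr_deriv ?_
      norm_num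
      try ring
    refine h1.exp.neg.congr_deriv ?_
    ring
  have hlim : Filter.Tendsto (fun t : ℝ => -exp (-t ^ 2 / 2)) Filter.atTop (nhds 0) := by
    rw [← neg_zero]
    refine Filter.Tendsto.neg ?_
    refine tendsto_exp_atBot.comp ?_
    have : Filter.Tendsto (fun t : ℝ => t ^ 2 / 2) Filter.atTop Filter.atTop :=
      (Filter.tendsto_pow_atTop two_ne_zero).atTop_div_const two_pos
    convert Filter.tendsto_neg_atTop_atBot.comp this using 2
    simp [neg_div]
  have hpos : ∀ x ∈ Ioi τ, 0 ≤ x * exp (-x ^ 2 / 2) := by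
    intro x hx
    have : 0 ≤ x := hτ.trans (le_of_lt hx)
    positivity
  have hi := integrableOn_Ioi_deriv_of_nonneg' hd hpos hlim
  have hv := integral_Ioi_of_hasDerivAt_of_nonneg' hd hpos hlim
  rw [← ofReal_integral_eq_lintegral_ofReal hi
    ((ae_restrict_iff' measurableSet_Ioi).2 (Filter.Eventually.of_forall hpos)), hv]
  simp

lemma ff_le {n : ℕ} {L : Set (EuclideanSpace ℝ (Fin n))} (v : EuclideanSpace ℝ (Fin n))
    (τ : ℝ) (hτ : 0 ≤ τ) (h : ∀ t : ℝ, 0 < t → t⁻¹ • v ∈ L → τ ≤ t) :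
    ff L v ≤ ENNReal.ofReal (exp (-τ ^ 2 / 2)) := by
  rw [← tail_int τ hτ, ff, ← setLIntegral_congr (Ioi_ae_eq_Ici (a := τ)).symm,
    ← lintegral_indicator measurableSet_Ioi, ← lintegral_indicator measurableSet_Ici]
  refine lintegral_mono fun t => ?_
  by_cases ht : 0 < t
  · by_cases hv : t⁻¹ • v ∈ L
    · have := h t ht hv
      simp [indicator, ht, hv, this]
    · simp [indicator, hv]
  · simp [indicator, ht]

lemma fg_le {n : ℕ} {L : Set (EuclideanSpace ℝ (Fin n))} (s : EuclideanSpace ℝ (Fin n) → ℝ)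
    (hs : ∀ v ∈ L, ∀ y, ⟪v, y⟫ ≤ s y) (hs0 : ∀ y, y ≠ 0 → 0 < s y)
    (v y : EuclideanSpace ℝ (Fin n)) :
    ff L v * ENNReal.ofReal (exp (-(s y) ^ 2 / 2)) ≤ ENNReal.ofReal (1 * exp (-⟪v, y⟫)) := by
  by_cases hd : ⟪v, y⟫ ≤ 0
  · have h1 := ff_le (L := L) v 0 le_rfl (fun t ht _ => ht.le)
    refine (mul_le_mul' h1 le_rfl).trans ?_
    rw [← ENNReal.ofReal_mul (by positivity)]
    apply ENNReal.ofReal_le_ofReal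
    rw [← exp_add, one_mul]
    apply exp_le_exp.2
    nlinarith [sq_nonneg (s y)]
  · push Not at hd
    have hy : y ≠ 0 := by rintro rfl; simp at hd
    have hsy := hs0 y hy
    have h1 := ff_le (L := L) v (⟪v, y⟫ / s y) (by positivity) (by
      intro t ht hv
      have := hs _ hv y
      rw [inner_smul_left] at this
      simp at this
      rw [div_le_iff₀ hsy]
      field_simp at this
      exact this)
    refine (mul_le_mul' h1 le_rfl).trans ?_
    rw [← ENNReal.ofReal_mul (by positivity)]
    apply ENNReal.ofReal_le_ofReal
    rw [← exp_add, one_mul]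
    apply exp_le_exp.2
    have h2 : ⟪v, y⟫ = (⟪v, y⟫ / s y) * s y := by field_simp
    nlinarith [sq_nonneg (⟪v, y⟫ / s y - s y)]

lemma polar_lint {n : ℕ} (hn : 1 ≤ n) (g : EuclideanSpace ℝ (Fin n) → ℝ≥0∞) (hg : Measurable g) :
    ∫⁻ y, g y = ∫⁻ u, ∫⁻ t in Ioi (0:ℝ), ENNReal.ofReal (t ^ (n - 1)) *
      g (t • (u : EuclideanSpace ℝ (Fin n))) ∂volume ∂(sphMeasure n) := by
  have : Nonempty (Fin n) := ⟨⟨0, hn⟩⟩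
  have hmp := Measure.measurePreserving_homeomorphUnitSphereProd
    (volume : Measure (EuclideanSpace ℝ (Fin n)))
  have hgm : Measurable (fun p : sphere (0 : EuclideanSpace ℝ (Fin n)) 1 × Ioi (0:ℝ) =>
      g ((p.2 : ℝ) • (p.1 : EuclideanSpace ℝ (Fin n)))) := by
    refine hg.comp ?_
    fun_prop
  have h1 : ∫⁻ y, g y = ∫⁻ y : ({(0:EuclideanSpace ℝ (Fin n))}ᶜ : Set _), g y ∂(Measure.comap Subtype.val volume) := by
    rw [lintegral_subtype_comap (measurableSet_singleton _).compl g, restrict_compl_singleton]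
  have h2 := hmp.lintegral_comp hgm
  rw [h1]
  have h3 : ∀ y : ({(0:EuclideanSpace ℝ (Fin n))}ᶜ : Set _), g y =
      g (((homeomorphUnitSphereProd (EuclideanSpace ℝ (Fin n)) y).2 : ℝ) •
        ((homeomorphUnitSphereProd (EuclideanSpace ℝ (Fin n)) y).1 : EuclideanSpace ℝ (Fin n))) := by
    intro y
    congr 1
    have := (homeomorphUnitSphereProd (EuclideanSpace ℝ (Fin n))).symm_apply_apply y
    exact (congrArg Subtype.val this).symm
  rw [lintegral_congr h3, h2, lintegral_prod _ hgm.aemeasurable]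
  refine lintegral_congr fun u => ?_
  rw [Measure.volumeIoiPow, lintegral_withDensity_eq_lintegral_mul _ (by fun_prop)
    (show Measurable (fun y : Ioi (0:ℝ) => g ((((u, y) :
      sphere (0 : EuclideanSpace ℝ (Fin n)) 1 × Ioi (0:ℝ)).2 : ℝ) • (((u, y) :
      sphere (0 : EuclideanSpace ℝ (Fin n)) 1 × Ioi (0:ℝ)).1 : EuclideanSpace ℝ (Fin n))))
      from hgm.comp measurable_prodMk_left)]
  rw [← lintegral_subtype_comap measurableSet_Ioi
    (fun t => ENNReal.ofReal (t ^ (n - 1)) * g (t • (u : EuclideanSpace ℝ (Fin n))))]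
  simp only [finrank_euclideanSpace, Fintype.card_fin]
  rfl

lemma gg_int {n : ℕ} (hn : 1 ≤ n) (s : EuclideanSpace ℝ (Fin n) → ℝ) (hsc : Continuous s)
    (hs0 : ∀ y, y ≠ 0 → 0 < s y) (hsm : ∀ (c : ℝ) y, 0 < c → s (c • y) = c * s y) :
    ∫⁻ y, ENNReal.ofReal (exp (-(s y) ^ 2 / 2)) =
      ENNReal.ofReal (√2 ^ n / 2 * Gamma ((n:ℝ) / 2)) *
        ∫⁻ u, ENNReal.ofReal (s (u : EuclideanSpace ℝ (Fin n)) ^ (-(n:ℝ))) ∂(sphMeasure n) := by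
  have hsm' : Measurable (fun u : sphere (0 : EuclideanSpace ℝ (Fin n)) 1 =>
      ENNReal.ofReal (s (u : EuclideanSpace ℝ (Fin n)) ^ (-(n:ℝ)))) := by
    have : Measurable s := hsc.measurable
    fun_prop
  rw [polar_lint hn _ (by fun_prop), ← lintegral_const_mul _ hsm']
  refine lintegral_congr fun u => ?_
  have hu : (u : EuclideanSpace ℝ (Fin n)) ≠ 0 := by
    have := mem_sphere_zero_iff_norm.1 u.2
    intro h
    rw [h] at this
    simp at this
  have hsu := hs0 _ hu
  have hg0 : 0 ≤ Gamma ((n:ℝ) / 2) := Gamma_nonneg_of_nonneg (by positivity)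
  have h := rad_int (n - 1) (s (u : EuclideanSpace ℝ (Fin n)) ^ 2 / 2) (by positivity)
  rw [Nat.cast_sub hn] at h
  rw [← ENNReal.ofReal_mul (by positivity)]
  have hR : (s (u : EuclideanSpace ℝ (Fin n)) ^ 2 / 2) ^ (-((n:ℝ) - (1:ℕ) + 1) / 2) * (1 / 2) *
      Gamma (((n:ℝ) - (1:ℕ) + 1) / 2) =
      √2 ^ n / 2 * Gamma ((n:ℝ) / 2) * s (u : EuclideanSpace ℝ (Fin n)) ^ (-(n:ℝ)) := by
    rw [show ((n:ℝ) - (1:ℕ) + 1) = n by simp, Real.div_rpow (by positivity) (by norm_num),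
      ← Real.rpow_natCast (s _) 2, ← Real.rpow_mul hsu.le,
      show ((2:ℕ):ℝ) * (-(n:ℝ) / 2) = -n by push_cast; ring,
      show -(n:ℝ) / 2 = -((1/2) * n) by ring, Real.rpow_neg (by norm_num : (0:ℝ) ≤ 2),
      Real.rpow_mul (by norm_num), ← Real.sqrt_eq_rpow, Real.rpow_natCast]
    field_simp
  rw [← hR, ← h]
  refine setLIntegral_congr_fun measurableSet_Ioi fun t ht => ?_
  have ht' : (0:ℝ) < t := ht
  rw [hsm t _ ht', ← ENNReal.ofReal_mul (by positivity)]
  congr 3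
  ring

lemma santalo_body {n : ℕ} (hn : 1 ≤ n) {K : Set (EuclideanSpace ℝ (Fin n))} (hK : IsCompact K)
    {x : EuclideanSpace ℝ (Fin n)} (hx : x ∈ interior K)
    (hbar : ∫ v in K, (v - x) = 0) (hV : volume K = volume (unitBall n)) :
    ∫⁻ u, ENNReal.ofReal ((supp K u - ⟪x, (u : EuclideanSpace ℝ (Fin n))⟫) ^ (-(n:ℝ)))
      ∂(sphMeasure n) ≤ ENNReal.ofReal (n * vol (unitBall n)) := by
  have : Nonempty (Fin n) := ⟨⟨0, hn⟩⟩
  set L : Set (EuclideanSpace ℝ (Fin n)) := (fun v => x + v) ⁻¹' K with hLdef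
  have hL : IsCompact L := (Homeomorph.addLeft x).isCompact_preimage.2 hK
  have hVL : volume L = volume (unitBall n) := by
    rw [hLdef, measure_preimage_add, hV]
  have hbL : ∫ v in L, v = 0 := by
    have := (measurePreserving_add_left (volume : Measure (EuclideanSpace ℝ (Fin n))) x).setIntegral_preimage_emb
      (measurableEmbedding_addLeft x) (fun w => w - x) K
    rw [hbar] at this
    rw [← this]
    simp [hLdef]
  have hb : volume (unitBall n) = ENNReal.ofReal (√π ^ n / Gamma ((n:ℝ) / 2 + 1)) := by
    rw [unitBall, EuclideanSpace.volume_closedBall]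
    simp
  have hG1 : 0 < Gamma ((n:ℝ) / 2 + 1) := Gamma_pos_of_pos (by positivity)
  have hn0 : (0:ℝ) < n := by exact_mod_cast hn
  have hG0 : 0 < Gamma ((n:ℝ) / 2) := Gamma_pos_of_pos (by positivity)
  have hGG : Gamma ((n:ℝ) / 2 + 1) = n / 2 * Gamma ((n:ℝ) / 2) := Gamma_add_one (by positivity)
  have hmass : ∫⁻ v, ff L v = ENNReal.ofReal (√2 ^ n * √π ^ n) := by
    rw [ff_mass hL.measurableSet, rho_univ, hVL, hb, ← ENNReal.ofReal_mul (by positivity)]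
    congr 1
    rw [show (n:ℝ) / 2 = (1/2) * n by ring, Real.rpow_mul (by norm_num), ← Real.sqrt_eq_rpow,
      Real.rpow_natCast]
    rw [show (1/2) * (n:ℝ) = (n:ℝ) / 2 by ring]
    field_simp
  set s : EuclideanSpace ℝ (Fin n) → ℝ := fun y => supp K y - ⟪x, y⟫ with hs
  have hsc : Continuous s := (supp_cont hK).sub (by fun_prop)
  have hs0 : ∀ y, y ≠ 0 → 0 < s y := fun y hy => supp_sub_pos hK hx hy
  have hsm : ∀ (c : ℝ) y, 0 < c → s (c • y) = c * s y := by
    intro c y hc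
    simp only [hs]
    rw [supp_smul K hc.le, inner_smul_right]
    ring
  have hle : ∀ v ∈ L, ∀ y, ⟪v, y⟫ ≤ s y := by
    intro v hv y
    have := le_supp hK (show x + v ∈ K from hv) y
    rw [inner_add_left] at this
    simp only [hs]
    linarith
  have hsan := santalo_fun n (ff L) (fun y => ENNReal.ofReal (exp (-(s y) ^ 2 / 2))) 1 one_pos
    (ff_meas hL.measurableSet) (by fun_prop) (by rw [hmass]; exact ENNReal.ofReal_ne_top)
    (ff_integrable hL) (ff_bary hL hbL) (fun v y => fg_le s hle hs0 v y)
  rw [hmass, gg_int hn s hsc hs0 hsm, ← mul_assoc, ← ENNReal.ofReal_mul (by positivity)] at hsan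
  have hfin : (2 * π) ^ n * 1 = (√2 ^ n * √π ^ n * (√2 ^ n / 2 * Gamma ((n:ℝ) / 2))) *
      (n * vol (unitBall n)) := by
    rw [vol, hb, ENNReal.toReal_ofReal (by positivity), hGG, mul_pow]
    have h2 : (2:ℝ) ^ n = √2 ^ n * √2 ^ n := by
      rw [← mul_pow, Real.mul_self_sqrt (by norm_num)]
    have h3 : π ^ n = √π ^ n * √π ^ n := by
      rw [← mul_pow, Real.mul_self_sqrt pi_pos.le]
    rw [h2, h3]
    field_simp
  rw [hfin, ENNReal.ofReal_mul (q := n * vol (unitBall n)) (by positivity)] at hsan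
  exact (ENNReal.mul_le_mul_iff_right (by
    rw [Ne, ENNReal.ofReal_eq_zero, not_le]; positivity) ENNReal.ofReal_ne_top).1 hsan

lemma bary_interior {n : ℕ} {K : Set (EuclideanSpace ℝ (Fin n))} (hK : IsConvexBody K) :
    ∃ x ∈ interior K, ∫ v in K, (v - x) = 0 := by
  obtain ⟨hc, hcv, z, hz⟩ := hK
  obtain ⟨r, hr, hb⟩ := Metric.isOpen_iff.1 isOpen_interior z hz
  have : IsFiniteMeasure (volume.restrict K) := ⟨by
    rw [Measure.restrict_apply_univ]; exact hc.measure_lt_top⟩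
  have hi : IntegrableOn (fun v : EuclideanSpace ℝ (Fin n) => v) K :=
    continuous_id.continuousOn.integrableOn_compact hc
  have hsub : closedBall z (r / 2) ⊆ interior K :=
    (closedBall_subset_ball (by linarith)).trans hb
  have hpos : (volume.restrict K) (closedBall z (r / 2)) ≠ 0 := by
    rw [Measure.restrict_apply measurableSet_closedBall,
      inter_eq_left.2 (hsub.trans interior_subset)]
    exact (measure_closedBall_pos _ _ (by linarith)).ne'
  refine ⟨⨍ v in K, v, ?_, ?_⟩
  · refine hcv.average_mem_interior_of_set hpos (ae_restrict_mem hc.measurableSet) hi ?_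
    apply hsub
    refine (convex_closedBall z (r/2)).set_average_mem isClosed_closedBall hpos (by finiteness)
      (ae_restrict_mem measurableSet_closedBall) hi.integrableOn
  · exact integral_sub_average _ _

instance sph_finite (n : ℕ) : IsFiniteMeasure (sphMeasure n) := by
  unfold sphMeasure; infer_instance

lemma sph_ne {n : ℕ} (u : sphere (0 : EuclideanSpace ℝ (Fin n)) 1) :
    (u : EuclideanSpace ℝ (Fin n)) ≠ 0 := by
  have := mem_sphere_zero_iff_norm.1 u.2
  intro h
  rw [h] at this
  simp at this

lemma sp_int {n : ℕ} {K : Set (EuclideanSpace ℝ (Fin n))} (hK : IsCompact K)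
    {x : EuclideanSpace ℝ (Fin n)} (hx : x ∈ interior K) (p : ℝ) :
    Integrable (fun u : sphere (0 : EuclideanSpace ℝ (Fin n)) 1 =>
      (supp K u - ⟪x, (u : EuclideanSpace ℝ (Fin n))⟫) ^ p) (sphMeasure n) := by
  have hc : Continuous (fun u : sphere (0 : EuclideanSpace ℝ (Fin n)) 1 =>
      (supp K u - ⟪x, (u : EuclideanSpace ℝ (Fin n))⟫) ^ p) := by
    refine Continuous.rpow_const (((supp_cont hK).comp continuous_subtype_val).sub (by fun_prop)) ?_
    intro u
    exact Or.inl (supp_sub_pos hK hx (sph_ne u)).ne'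
  have hcomp : CompactSpace (sphere (0 : EuclideanSpace ℝ (Fin n)) 1) :=
    isCompact_iff_compactSpace.1 (isCompact_sphere _ _)
  exact hc.integrable_of_hasCompactSupport (HasCompactSupport.of_compactSpace _)

lemma sph_total (n : ℕ) : ((sphMeasure n) univ).toReal = n * vol (unitBall n) := by
  have := Measure.toSphere_real_apply_univ (volume : Measure (EuclideanSpace ℝ (Fin n)))
  rw [finrank_euclideanSpace, Fintype.card_fin] at this
  rw [sphMeasure, ← Measure.real, this]
  rcases Nat.eq_zero_or_pos n with rfl | h
  · simp
  · have : Nonempty (Fin n) := ⟨⟨0, h⟩⟩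
    rw [vol, unitBall, Measure.addHaar_closedBall_eq_addHaar_ball, Measure.real]

lemma comp_ge {n : ℕ} (hn : 2 ≤ n) {K : Set (EuclideanSpace ℝ (Fin n))} (hK : IsConvexBody K)
    (hV : volume K = volume (unitBall n)) :
    ∃ x ∈ interior K, ∫ u, (supp K u - ⟪x, (u : EuclideanSpace ℝ (Fin n))⟫) ^ (-2 : ℝ)
      ∂(sphMeasure n) ≤ n * vol (unitBall n) := by
  obtain ⟨x, hx, hbar⟩ := bary_interior hK
  refine ⟨x, hx, ?_⟩
  have h := santalo_body (by omega) hK.1 hx hbar hV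
  have hpos : ∀ u : sphere (0 : EuclideanSpace ℝ (Fin n)) 1,
      0 < supp K u - ⟪x, (u : EuclideanSpace ℝ (Fin n))⟫ :=
    fun u => supp_sub_pos hK.1 hx (sph_ne u)
  have hVn : 0 ≤ vol (unitBall n) := ENNReal.toReal_nonneg
  rw [← ofReal_integral_eq_lintegral_ofReal (sp_int hK.1 hx _)
    (Filter.Eventually.of_forall fun u => (rpow_pos_of_pos (hpos u) _).le),
    ENNReal.ofReal_le_ofReal_iff (by positivity)] at h
  have hn2 : (2:ℝ) ≤ n := by exact_mod_cast hn
  have hn0 : (0:ℝ) < n := by linarith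
  have h2n : 2 / (n:ℝ) ≤ 1 := by rw [div_le_one hn0]; exact hn2
  have hle : ∀ u : sphere (0 : EuclideanSpace ℝ (Fin n)) 1,
      (supp K u - ⟪x, (u : EuclideanSpace ℝ (Fin n))⟫) ^ (-2 : ℝ) ≤
      2 / n * (supp K u - ⟪x, (u : EuclideanSpace ℝ (Fin n))⟫) ^ (-(n:ℝ)) + (1 - 2 / n) := by
    intro u
    have := Real.geom_mean_le_arith_mean2_weighted (w₁ := 2 / n) (w₂ := 1 - 2 / n)
      (p₁ := (supp K u - ⟪x, (u : EuclideanSpace ℝ (Fin n))⟫) ^ (-(n:ℝ))) (p₂ := 1)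
      (by positivity) (by linarith) (rpow_pos_of_pos (hpos u) _).le zero_le_one (by ring)
    rw [← Real.rpow_mul (hpos u).le, Real.one_rpow, mul_one, mul_one,
      show -(n:ℝ) * (2 / n) = -2 by field_simp] at this
    exact this
  have hintg := sp_int hK.1 hx (-(n:ℝ))
  calc _ ≤ ∫ u, (2 / n * (supp K u - ⟪x, (u : EuclideanSpace ℝ (Fin n))⟫) ^ (-(n:ℝ)) + (1 - 2 / n))
        ∂(sphMeasure n) :=
        integral_mono (sp_int hK.1 hx _) ((hintg.const_mul _).add (integrable_const _)) hle
    _ = 2 / n * (∫ u, (supp K u - ⟪x, (u : EuclideanSpace ℝ (Fin n))⟫) ^ (-(n:ℝ)) ∂(sphMeasure n))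
        + n * vol (unitBall n) * (1 - 2 / n) := by
        rw [integral_add (hintg.const_mul _) (integrable_const _), integral_const_mul, integral_const,
          Measure.real, sph_total, smul_eq_mul]
    _ ≤ 2 / n * (n * vol (unitBall n)) + n * vol (unitBall n) * (1 - 2 / n) := by gcongr
    _ = _ := by ring

lemma norm_one_dim (v : EuclideanSpace ℝ (Fin 1)) : ‖v‖ = |v 0| := by
  rw [EuclideanSpace.norm_eq]; simp [Real.sqrt_sq_eq_abs]

lemma inner_one_dim (v w : EuclideanSpace ℝ (Fin 1)) : ⟪v, w⟫ = v 0 * w 0 := by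
  rw [PiLp.inner_apply]; simp [mul_comm]

lemma comp_one {K : Set (EuclideanSpace ℝ (Fin 1))} (hK : IsConvexBody K)
    (hV : volume K = volume (unitBall 1)) :
    ∃ x ∈ interior K, ∫ u, (supp K u - ⟪x, (u : EuclideanSpace ℝ (Fin 1))⟫) ^ (-2 : ℝ)
      ∂(sphMeasure 1) ≤ (1:ℕ) * vol (unitBall 1) := by
  have hne : K.Nonempty := hK.2.2.mono interior_subset
  have hc0 : ContinuousOn (fun v : EuclideanSpace ℝ (Fin 1) => v 0) K := by fun_prop
  obtain ⟨p, hp, hpm⟩ := hK.1.exists_isMaxOn hne hc0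
  obtain ⟨q, hq, hqm⟩ := hK.1.exists_isMinOn hne hc0
  set m : EuclideanSpace ℝ (Fin 1) := (1/2 : ℝ) • (p + q) with hm
  have hm0 : m 0 = (p 0 + q 0) / 2 := by simp [hm]; ring
  have hsub : K ⊆ closedBall m ((p 0 - q 0) / 2) := by
    intro v hv
    have h1 : v 0 ≤ p 0 := hpm hv
    have h2 : q 0 ≤ v 0 := hqm hv
    rw [mem_closedBall, dist_eq_norm, norm_one_dim, PiLp.sub_apply, hm0, abs_le]
    constructor <;> linarith
  have hr : 1 ≤ (p 0 - q 0) / 2 := by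
    by_contra hlt
    push Not at hlt
    have h1 := measure_mono (μ := volume) hsub
    rw [hV, unitBall, EuclideanSpace.volume_closedBall, EuclideanSpace.volume_closedBall] at h1
    have hcpos : ENNReal.ofReal (√π ^ Fintype.card (Fin 1) / Gamma ((Fintype.card (Fin 1) : ℝ) / 2 + 1)) ≠ 0 := by
      have : 0 < Gamma ((Fintype.card (Fin 1) : ℝ) / 2 + 1) := Gamma_pos_of_pos (by positivity)
      rw [Ne, ENNReal.ofReal_eq_zero, not_le]
      positivity
    rw [ENNReal.mul_le_mul_iff_left hcpos ENNReal.ofReal_ne_top] at h1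
    simp at h1
    linarith
  have hball : ball m ((p 0 - q 0) / 2) ⊆ K := by
    intro w hw
    rw [mem_ball, dist_eq_norm, norm_one_dim, PiLp.sub_apply, hm0, abs_lt] at hw
    have hpq : 0 < p 0 - q 0 := by linarith
    have := convex_iff_forall_pos.1 hK.2.1 hq hp
      (show 0 < (p 0 - w 0) / (p 0 - q 0) from div_pos (by linarith) hpq)
      (show 0 < (w 0 - q 0) / (p 0 - q 0) from div_pos (by linarith) hpq) (by field_simp; ring)
    convert this using 1
    ext i
    rw [Subsingleton.elim i 0]
    simp
    field_simp
    ring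
  have hmi : m ∈ interior K :=
    interior_maximal hball isOpen_ball (mem_ball_self (by linarith))
  refine ⟨m, hmi, ?_⟩
  have hge : ∀ u : sphere (0 : EuclideanSpace ℝ (Fin 1)) 1,
      1 ≤ supp K u - ⟪m, (u : EuclideanSpace ℝ (Fin 1))⟫ := by
    intro u
    have hu := mem_sphere_zero_iff_norm.1 u.2
    have h1 := le_supp hK.1 hp (u : EuclideanSpace ℝ (Fin 1))
    have h2 := le_supp hK.1 hq (u : EuclideanSpace ℝ (Fin 1))
    rw [norm_one_dim] at hu
    rw [inner_one_dim] at h1 h2 ⊢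
    rw [hm0]
    rcases eq_or_eq_neg_of_abs_eq hu with h | h <;> rw [h] at h1 h2 ⊢ <;> linarith
  calc _ ≤ ∫ u, (1:ℝ) ∂(sphMeasure 1) := by
        refine integral_mono (sp_int hK.1 hmi _) (integrable_const _) fun u => ?_
        exact Real.rpow_le_one_of_one_le_of_nonpos (hge u) (by norm_num)
    _ = _ := by
      rw [integral_const, Measure.real, sph_total]; simp

/-- Bounds on `∫ s_{-2}^{-2} dθ` and on the constant `r`. -/
theorem statement8 (n : ℕ) (hn : 1 ≤ n) (ε : ℝ) (hε0 : 0 < ε) (hε1 : ε < 1)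
    (K : Set (EuclideanSpace ℝ (Fin n))) (hK : IsConvexBody K)
    (hvol : vol K = vol (unitBall n))
    (hent : entropyP (-1) K / (n * vol (unitBall n)) ≥ 1 - ε)
    (e₂ : EuclideanSpace ℝ (Fin n)) (he₂ : e₂ ∈ interior K)
    (he₂min : ∀ x ∈ interior K,
      (∫ u, (supp K u - ⟪e₂, (u : EuclideanSpace ℝ (Fin n))⟫) ^ (-2 : ℝ) ∂(sphMeasure n))
        ≤ ∫ u, (supp K u - ⟪x, (u : EuclideanSpace ℝ (Fin n))⟫) ^ (-2 : ℝ) ∂(sphMeasure n)) :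
    (n * vol (unitBall n) * (1 - ε) ^ 2
        ≤ ∫ u, (supp K u - ⟪e₂, (u : EuclideanSpace ℝ (Fin n))⟫) ^ (-2 : ℝ) ∂(sphMeasure n)) ∧
    (∫ u, (supp K u - ⟪e₂, (u : EuclideanSpace ℝ (Fin n))⟫) ^ (-2 : ℝ) ∂(sphMeasure n))
        ≤ n * vol (unitBall n) ∧
    1 ≤ rConst K e₂ ∧ rConst K e₂ ≤ 1 / (1 - ε) := by
  have hfinB : volume (unitBall n) ≠ ∞ := (isCompact_closedBall _ _).measure_lt_top.ne
  have hV : volume K = volume (unitBall n) :=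
    (ENNReal.toReal_eq_toReal_iff' hK.1.measure_lt_top.ne hfinB).1 hvol
  have hn0 : (0:ℝ) < n := by exact_mod_cast hn
  have hVB : 0 < vol (unitBall n) :=
    ENNReal.toReal_pos (measure_closedBall_pos _ _ one_pos).ne' hfinB
  have hT : 0 < n * vol (unitBall n) := by positivity
  have hpos : ∀ x ∈ interior K, ∀ u : sphere (0 : EuclideanSpace ℝ (Fin n)) 1,
      0 < supp K u - ⟪x, (u : EuclideanSpace ℝ (Fin n))⟫ :=
    fun x hx u => supp_sub_pos hK.1 hx (sph_ne u)
  have hlow : n * vol (unitBall n) * (1 - ε) ^ 2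
      ≤ ∫ u, (supp K u - ⟪e₂, (u : EuclideanSpace ℝ (Fin n))⟫) ^ (-2 : ℝ) ∂(sphMeasure n) := by
    have h1 : entropyP (-1) K ≤
        ∫ u, (supp K u - ⟪e₂, (u : EuclideanSpace ℝ (Fin n))⟫) ^ (-1 : ℝ) ∂(sphMeasure n) := by
      refine csInf_le ⟨0, ?_⟩ ⟨e₂, he₂, rfl⟩
      rintro _ ⟨x, hx, rfl⟩
      exact integral_nonneg fun u => (rpow_pos_of_pos (hpos x hx u) _).le
    have h2 : (1 - ε) * (n * vol (unitBall n)) ≤ entropyP (-1) K := (le_div_iff₀ hT).1 hent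
    have hle : ∀ u : sphere (0 : EuclideanSpace ℝ (Fin n)) 1,
        2 * (1 - ε) * (supp K u - ⟪e₂, (u : EuclideanSpace ℝ (Fin n))⟫) ^ (-1 : ℝ) - (1 - ε) ^ 2 ≤
        (supp K u - ⟪e₂, (u : EuclideanSpace ℝ (Fin n))⟫) ^ (-2 : ℝ) := by
      intro u
      have := hpos e₂ he₂ u
      have h3 : (supp K u - ⟪e₂, (u : EuclideanSpace ℝ (Fin n))⟫) ^ (-2 : ℝ) =
          ((supp K u - ⟪e₂, (u : EuclideanSpace ℝ (Fin n))⟫) ^ (-1 : ℝ)) ^ 2 := by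
        rw [← Real.rpow_natCast, ← Real.rpow_mul this.le]
        norm_num
      rw [h3]
      nlinarith [sq_nonneg ((supp K u - ⟪e₂, (u : EuclideanSpace ℝ (Fin n))⟫) ^ (-1 : ℝ) - (1 - ε))]
    have hintg := sp_int hK.1 he₂ (-1)
    have h4 := integral_mono ((hintg.const_mul (2 * (1 - ε))).sub (integrable_const ((1 - ε) ^ 2)))
      (sp_int hK.1 he₂ (-2)) hle
    have h5 := integral_sub (hintg.const_mul (2 * (1 - ε))) (integrable_const (μ := sphMeasure n) ((1 - ε) ^ 2))
    rw [integral_const_mul, integral_const, Measure.real, sph_total, smul_eq_mul] at h5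
    have h6 := h5.symm.trans_le h4
    nlinarith
  have hup : (∫ u, (supp K u - ⟪e₂, (u : EuclideanSpace ℝ (Fin n))⟫) ^ (-2 : ℝ) ∂(sphMeasure n))
        ≤ n * vol (unitBall n) := by
    rcases eq_or_lt_of_le hn with h | h
    · subst h
      obtain ⟨x, hx, hle⟩ := comp_one hK hV
      exact (he₂min x hx).trans hle
    · obtain ⟨x, hx, hle⟩ := comp_ge h hK hV
      exact (he₂min x hx).trans hle
  have hI : 0 < ∫ u, (supp K u - ⟪e₂, (u : EuclideanSpace ℝ (Fin n))⟫) ^ (-2 : ℝ) ∂(sphMeasure n) := by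
    refine lt_of_lt_of_le ?_ hlow
    have : 0 < 1 - ε := by linarith
    positivity
  refine ⟨hlow, hup, ?_, ?_⟩
  · rw [rConst, sph_total, one_le_div (by positivity)]
    exact Real.rpow_le_rpow hI.le hup (by norm_num)
  · have h1 : 0 < 1 - ε := by linarith
    rw [rConst, sph_total, div_le_div_iff₀ (by positivity) h1, one_mul]
    calc (n * vol (unitBall n)) ^ ((1:ℝ)/2) * (1 - ε)
        = (n * vol (unitBall n) * (1 - ε) ^ 2) ^ ((1:ℝ)/2) := by
          rw [Real.mul_rpow hT.le (by positivity), ← Real.sqrt_eq_rpow ((1 - ε) ^ 2), Real.sqrt_sq h1.le]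
      _ ≤ _ := Real.rpow_le_rpow (by positivity) hlow (by norm_num)
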